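/- arXiv:2507.09388 — 4 statements merged into one kernel-verified Lean document; each statement's English description precedes it below -/
import Mathlib

section
/- Suppose the link function F satisfies conditions (A0), (A1) and (A2). If the Laplace noise scale satisfies λ ≥ 8κ₁/ε and the ridge penalty satisfies γ ≥ 4κ₂/ε, then the perturbed maximum likelihood estimator θ̃ = argmin_{θ∈ℝⁿ} L(θ;y) + (γ/2)‖θ‖₂² + wᵀθ, with w₁,…,w_n i.i.d. Laplace(λ), is (ε,0)-edge-differentially private: for any two edge-adjacent comparison datasets y, y′ and any measurable set A, P(θ̃(y)∈A) ≤ e^ε · P(θ̃(y′)∈A). -/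
open MeasureTheory ProbabilityTheory
open scoped ENNReal

namespace PrivateRanking

instance : MeasurableSpace (Option Bool) := ⊤

/-- The index set of potential comparisons: ordered pairs `(i, j)` with `i < j`. -/
abbrev Pair (n : ℕ) := {q : Fin n × Fin n // q.1 < q.2}

/-- A dataset of pairwise comparisons: for each pair `(i,j)` with `i < j`, either `none`
(the pair was not compared) or `some b`, where `b = true` iff item `i` beat item `j`. -/
abbrev EdgeData (n : ℕ) := Pair n → Option Bool

/-- Edge adjacency: either the comparison graphs are identical and exactly one comparison
outcome differs, or the graphs differ by exactly one edge and all outcomes on common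
edges agree. -/
def EdgeAdjacent {n : ℕ} (d d' : EdgeData n) : Prop :=
  (∃ q, (d q).isSome ∧ (d' q).isSome ∧ d q ≠ d' q ∧ ∀ r, r ≠ q → d r = d' r) ∨
  (∃ q₁ q₂, q₁ ≠ q₂ ∧ (d q₁).isSome ∧ d' q₁ = none ∧ d q₂ = none ∧ (d' q₂).isSome ∧
    ∀ r, r ≠ q₁ → r ≠ q₂ → d r = d' r)

/-- Contribution of a single observed comparison with outcome `b` to the negative
log-likelihood: `-y log F - (1-y) log (1-F)`. -/
noncomputable def nllTerm (F : ℝ → ℝ) (x : ℝ) (b : Bool) : ℝ :=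
  if b then -Real.log (F x) else -Real.log (1 - F x)

/-- The negative log-likelihood `L(θ; y)` of the comparison data `d`. -/
noncomputable def nll (n : ℕ) (F : ℝ → ℝ) (θ : Fin n → ℝ) (d : EdgeData n) : ℝ :=
  ∑ q : Pair n, (d q).elim 0 (fun b => nllTerm F (θ q.1.1 - θ q.1.2) b)

/-- The perturbed and ridge-regularized objective
`L(θ; y) + (γ/2)‖θ‖₂² + wᵀθ`. -/
noncomputable def pobj (n : ℕ) (F : ℝ → ℝ) (γ : ℝ) (w : Fin n → ℝ) (d : EdgeData n)
    (θ : Fin n → ℝ) : ℝ :=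
  nll n F θ d + γ / 2 * ∑ i, θ i ^ 2 + ∑ i, w i * θ i

/-- The Laplace distribution with scale `b`, via its density `(2b)⁻¹ exp (-|x|/b)`. -/
noncomputable def laplaceMeasure (b : ℝ) : Measure ℝ :=
  volume.withDensity fun x => ENNReal.ofReal ((2 * b)⁻¹ * Real.exp (-|x| / b))

/-- The law of `n` i.i.d. Laplace(b) random variables. -/
noncomputable def laplacePi (n : ℕ) (b : ℝ) : Measure (Fin n → ℝ) :=
  Measure.pi fun _ => laplaceMeasure b

/-- (A0): `F` is strictly increasing and symmetric, `F x = 1 - F (-x)`. -/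
def CondA0 (F : ℝ → ℝ) : Prop := StrictMono F ∧ ∀ x, F x = 1 - F (-x)

/-- (A1): `sup_x |F'(x)/(F(x)(1-F(x)))| < κ₁`. -/
def CondA1 (F : ℝ → ℝ) (κ₁ : ℝ) : Prop :=
  0 < κ₁ ∧ Differentiable ℝ F ∧ ∀ x, |deriv F x / (F x * (1 - F x))| < κ₁

/-- (A2): `(-log F)'' > 0` everywhere, `(-log F)'' < κ₂`, and
`(-log F)'' > 1/κ₂` on `[-4, 4]`. -/
def CondA2 (F : ℝ → ℝ) (κ₂ : ℝ) : Prop :=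
  0 < κ₂ ∧ (∀ x, 0 < deriv (deriv fun y => -Real.log (F y)) x) ∧
    (∀ x, deriv (deriv fun y => -Real.log (F y)) x < κ₂) ∧
    (∀ x, |x| ≤ 4 → κ₂⁻¹ < deriv (deriv fun y => -Real.log (F y)) x)

open Matrix in
lemma lintegral_pi_prod (n : ℕ) (μ : Fin n → Measure ℝ) [∀ i, SigmaFinite (μ i)]
    (f : Fin n → ℝ → ℝ≥0∞) (hf : ∀ i, Measurable (f i)) :
    ∫⁻ x : Fin n → ℝ, ∏ i, f i (x i) ∂(Measure.pi μ) = ∏ i, ∫⁻ x, f i x ∂(μ i) := by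
  induction n with
  | zero => simp
  | succ n ih =>
    have h := (measurePreserving_piFinSuccAbove μ 0).symm
    rw [← h.lintegral_comp_emb (MeasurableEquiv.measurableEmbedding _)]
    simp only [Fin.prod_univ_succ]
    have : ∀ z : ℝ × (Fin n → ℝ),
        (f 0 ((MeasurableEquiv.piFinSuccAbove (fun _ => ℝ) 0).symm z 0) *
          ∏ i : Fin n, f i.succ ((MeasurableEquiv.piFinSuccAbove (fun _ => ℝ) 0).symm z i.succ))
        = f 0 z.1 * ∏ i : Fin n, f i.succ (z.2 i) := by
      intro z
      simp [MeasurableEquiv.piFinSuccAbove]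
    simp_rw [this]
    rw [lintegral_prod_mul (f := f 0) (g := fun y : Fin n → ℝ => ∏ i : Fin n, f i.succ (y i))
      (hf 0).aemeasurable
      (Finset.measurable_prod _ fun i _ => (hf _).comp (measurable_pi_apply i)).aemeasurable]
    have := ih (fun i => μ i.succ) (fun i => f i.succ) (fun i => hf _)
    simp only [Fin.zero_succAbove]
    rw [this]

noncomputable def lapDens (b x : ℝ) : ℝ := (2 * b)⁻¹ * Real.exp (-|x| / b)

lemma measurable_lapDens (b : ℝ) : Measurable (lapDens b) := by
  unfold lapDens
  fun_prop

lemma laplacePi_eq (n : ℕ) (b : ℝ) :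
    laplacePi n b = (volume : Measure (Fin n → ℝ)).withDensity
      (fun w => ∏ i, ENNReal.ofReal (lapDens b (w i))) := by
  have hm : Measurable fun x => ENNReal.ofReal (lapDens b x) :=
    (measurable_lapDens b).ennreal_ofReal
  have : SigmaFinite (laplaceMeasure b) :=
    SigmaFinite.withDensity_ofReal (lapDens b)
  have he : laplaceMeasure b = volume.withDensity fun x => ENNReal.ofReal (lapDens b x) := rfl
  unfold laplacePi
  refine Measure.pi_eq fun s hs => ?_
  rw [withDensity_apply _ (MeasurableSet.univ_pi hs), volume_pi, Measure.restrict_pi_pi]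
  have h := lintegral_pi_prod n (fun i => (volume : Measure ℝ).restrict (s i))
    (fun _ x => ENNReal.ofReal (lapDens b x)) (fun _ => hm)
  refine h.trans (Finset.prod_congr rfl fun i _ => ?_)
  rw [he, withDensity_apply _ (hs i)]

lemma lap_ratio (n : ℕ) (b c : ℝ) (hb : 0 < b) (u v : Fin n → ℝ)
    (h : ∑ i, |u i - v i| ≤ c * b) :
    ∏ i, ENNReal.ofReal (lapDens b (u i)) ≤
      ENNReal.ofReal (Real.exp c) * ∏ i, ENNReal.ofReal (lapDens b (v i)) := by
  have h0 : ∀ x, 0 ≤ lapDens b x := fun x => by unfold lapDens; positivity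
  rw [← ENNReal.ofReal_prod_of_nonneg (fun i _ => h0 _),
    ← ENNReal.ofReal_prod_of_nonneg (fun i _ => h0 _), ← ENNReal.ofReal_mul (Real.exp_pos _).le]
  apply ENNReal.ofReal_le_ofReal
  unfold lapDens
  simp only [Finset.prod_mul_distrib, ← Real.exp_sum]
  rw [mul_left_comm, ← Real.exp_add]
  gcongr
  rw [← Finset.sum_div, ← Finset.sum_div, div_le_iff₀ hb, add_mul, div_mul_cancel₀ _ hb.ne']
  have : ∑ i, (-|u i|) - ∑ i, (-|v i|) ≤ ∑ i, |u i - v i| := by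
    rw [← Finset.sum_sub_distrib]
    refine Finset.sum_le_sum fun i _ => ?_
    have := abs_sub_abs_le_abs_sub (v i) (u i)
    rw [abs_sub_comm] at this
    linarith
  linarith

open Matrix in
lemma det_rank_one {n : ℕ} (γ a : ℝ) (hγ : 0 < γ) (ha : 0 ≤ a) (P : Matrix (Fin n) (Fin n) ℝ)
    (hP : P.PosSemidef) (v : Fin n → ℝ) :
    0 < (γ • (1 : Matrix (Fin n) (Fin n) ℝ) + P).det ∧
    (γ • (1 : Matrix (Fin n) (Fin n) ℝ) + P).det ≤
      (γ • (1 : Matrix (Fin n) (Fin n) ℝ) + P + a • vecMulVec v v).det ∧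
    (γ • (1 : Matrix (Fin n) (Fin n) ℝ) + P + a • vecMulVec v v).det ≤
      (1 + a * (v ⬝ᵥ v) / γ) * (γ • (1 : Matrix (Fin n) (Fin n) ℝ) + P).det := by
  set M := γ • (1 : Matrix (Fin n) (Fin n) ℝ) + P with hM
  have hMp : M.PosDef := (PosDef.one.smul hγ).add_posSemidef hP
  have hdet := hMp.det_pos
  have hu : IsUnit M.det := hdet.ne'.isUnit
  have key : (M + a • vecMulVec v v).det = M.det * (1 + a * (v ⬝ᵥ (M⁻¹ *ᵥ v))) := by
    have h1 : a • vecMulVec v v = replicateCol Unit (a • v) * replicateRow Unit v := by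
      rw [← vecMulVec_eq, smul_vecMulVec]
    rw [h1, det_add_replicateCol_mul_replicateRow hu]
    congr 1
    rw [det_unique, Matrix.mul_assoc]
    simp [Matrix.mul_apply, dotProduct, mulVec, Finset.mul_sum]
  set x := M⁻¹ *ᵥ v with hx
  have hv : v = M *ᵥ x := by
    rw [hx, mulVec_mulVec, mul_nonsing_inv _ hu, one_mulVec]
  have hPx : 0 ≤ x ⬝ᵥ (P *ᵥ x) := by
    simpa using hP.dotProduct_mulVec_nonneg x
  have hvx : v ⬝ᵥ x = γ * (x ⬝ᵥ x) + x ⬝ᵥ (P *ᵥ x) := by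
    rw [hv, dotProduct_comm, hM, add_mulVec, dotProduct_add, smul_mulVec, one_mulVec,
      dotProduct_smul, smul_eq_mul]
  have hxx : 0 ≤ x ⬝ᵥ x := Finset.sum_nonneg fun i _ => mul_self_nonneg _
  have hvv : 0 ≤ v ⬝ᵥ v := Finset.sum_nonneg fun i _ => mul_self_nonneg _
  have h0 : 0 ≤ v ⬝ᵥ x := by rw [hvx]; positivity
  have cs : (v ⬝ᵥ x) ^ 2 ≤ (v ⬝ᵥ v) * (x ⬝ᵥ x) := by
    have := Finset.sum_mul_sq_le_sq_mul_sq Finset.univ v x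
    simpa [dotProduct, sq] using this
  have hle : v ⬝ᵥ x ≤ (v ⬝ᵥ v) / γ := by
    rw [le_div_iff₀ hγ]
    rcases h0.eq_or_lt with h | h
    · rw [← h]; simpa using hvv
    · have : (v ⬝ᵥ x) * ((v ⬝ᵥ x) * γ) ≤ (v ⬝ᵥ x) * (v ⬝ᵥ v) := by nlinarith
      exact le_of_mul_le_mul_left this h
  refine ⟨hdet, ?_, ?_⟩
  · rw [key]
    have : 0 ≤ a * (v ⬝ᵥ x) := by positivity
    nlinarith
  · rw [key, mul_comm]
    gcongr
    rw [mul_div_assoc]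
    gcongr

lemma F_pos {F : ℝ → ℝ} {κ₁ : ℝ} (hF0 : CondA0 F) (hF1 : CondA1 F κ₁) (x : ℝ) : 0 < F x := by
  obtain ⟨hmono, hsym⟩ := hF0
  obtain ⟨hκ, hd, hb⟩ := hF1
  by_contra! hx
  have h00 : F 0 = 1 / 2 := by have := hsym 0; simp at this; linarith
  have hx0 : x ≤ 0 := by
    by_contra! h
    have := hmono h
    linarith
  obtain ⟨z, hz, hFz⟩ := intermediate_value_Icc hx0 hd.continuous.continuousOn
    (show (0 : ℝ) ∈ Set.Icc (F x) (F 0) from ⟨hx, by rw [h00]; norm_num⟩)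
  have hz0 : z ≤ 0 := hz.2
  have hG : ∀ y, HasDerivAt (fun y => F y * Real.exp (-κ₁ * y))
      (deriv F y * Real.exp (-κ₁ * y) + F y * (Real.exp (-κ₁ * y) * -κ₁)) y := by
    intro y
    refine (hd y).hasDerivAt.mul ?_
    simpa using ((hasDerivAt_id y).const_mul (-κ₁)).exp
  have anti : AntitoneOn (fun y => F y * Real.exp (-κ₁ * y)) (Set.Icc z 0) := by
    apply antitoneOn_of_deriv_nonpos (convex_Icc _ _)
    · exact fun y _ => (hG y).continuousAt.continuousWithinAt
    · exact fun y _ => (hG y).differentiableAt.differentiableWithinAt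
    · intro y hy
      rw [interior_Icc] at hy
      rw [(hG y).deriv]
      have h1 : 0 < F y := by have := hmono hy.1; linarith
      have h2 : F y < 1 / 2 := by have := hmono hy.2; linarith
      have h3 : deriv F y ≤ κ₁ * F y := by
        have h4 := (abs_lt.1 (hb y)).2
        have h5 : 0 < F y * (1 - F y) := mul_pos h1 (by linarith)
        rw [div_lt_iff₀ h5] at h4
        nlinarith [mul_pos hκ (mul_pos h1 h1)]
      have := Real.exp_pos (-κ₁ * y)
      nlinarith
  have := anti (Set.left_mem_Icc.2 hz0) (Set.right_mem_Icc.2 hz0) hz0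
  simp [hFz, h00] at this
  linarith

noncomputable def g1 (ψ : ℝ → ℝ) (o : Option Bool) (x : ℝ) : ℝ :=
  o.elim 0 (fun b => if b then deriv ψ x else -deriv ψ (-x))

noncomputable def g2 (ψ : ℝ → ℝ) (o : Option Bool) (x : ℝ) : ℝ :=
  o.elim 0 (fun b => if b then deriv (deriv ψ) x else deriv (deriv ψ) (-x))

noncomputable def vv {n : ℕ} (q : Pair n) : Fin n → ℝ := Pi.single q.1.1 1 - Pi.single q.1.2 1

open Matrix in
lemma vv_dot {n : ℕ} (q : Pair n) (θ : Fin n → ℝ) : vv q ⬝ᵥ θ = θ q.1.1 - θ q.1.2 := by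
  simp [vv, sub_dotProduct]

open Matrix in
lemma vv_self {n : ℕ} (q : Pair n) : vv q ⬝ᵥ vv q = 2 := by
  have h : q.1.1 ≠ q.1.2 := q.2.ne
  rw [vv_dot]
  simp [vv, h, h.symm]
  norm_num

lemma vv_abs {n : ℕ} (q : Pair n) : ∑ i, |vv q i| ≤ 2 := by
  calc ∑ i, |vv q i| ≤ ∑ i, ((Pi.single q.1.1 1 : Fin n → ℝ) i + (Pi.single q.1.2 1 : Fin n → ℝ) i) := by
        refine Finset.sum_le_sum fun i _ => ?_
        simp only [vv, Pi.sub_apply]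
        refine (abs_sub _ _).trans ?_
        have h : ∀ j, 0 ≤ (Pi.single j 1 : Fin n → ℝ) i := fun j => by
          simp only [Pi.single_apply]; split_ifs <;> norm_num
        rw [abs_of_nonneg (h _), abs_of_nonneg (h _)]
    _ = 2 := by rw [Finset.sum_add_distrib]; simp; norm_num

open Matrix in
noncomputable def TT {n : ℕ} (ψ : ℝ → ℝ) (γ : ℝ) (d : EdgeData n) (θ : Fin n → ℝ) : Fin n → ℝ :=
  -(∑ q, g1 ψ (d q) (vv q ⬝ᵥ θ) • vv q + γ • θ)

open Matrix in
noncomputable def PP {n : ℕ} (ψ : ℝ → ℝ) (d : EdgeData n) (θ : Fin n → ℝ) :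
    Matrix (Fin n) (Fin n) ℝ :=
  ∑ q, g2 ψ (d q) (vv q ⬝ᵥ θ) • vecMulVec (vv q) (vv q)

open Matrix in
noncomputable def HH {n : ℕ} (ψ : ℝ → ℝ) (γ : ℝ) (d : EdgeData n) (θ : Fin n → ℝ) :
    Matrix (Fin n) (Fin n) ℝ :=
  γ • (1 : Matrix (Fin n) (Fin n) ℝ) + PP ψ d θ

lemma sum_update {n : ℕ} {E : Type*} [AddCommGroup E] (d0 : EdgeData n) (q : Pair n)
    (h0 : d0 q = none) (o : Option Bool) (f : Pair n → Option Bool → E) (hf : f q none = 0) :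
    ∑ r, f r (Function.update d0 q o r) = ∑ r, f r (d0 r) + f q o := by
  rw [← Finset.add_sum_erase _ _ (Finset.mem_univ q),
    ← Finset.add_sum_erase _ (fun r => f r (d0 r)) (Finset.mem_univ q)]
  simp only [Function.update_self, h0, hf, zero_add]
  rw [add_comm]
  congr 1
  refine Finset.sum_congr rfl fun r hr => ?_
  rw [Function.update_of_ne (Finset.ne_of_mem_erase hr)]

lemma adj_common {n : ℕ} {d d' : EdgeData n} (h : EdgeAdjacent d d') :
    ∃ (d0 : EdgeData n) (q q' : Pair n) (o o' : Option Bool), d0 q = none ∧ d0 q' = none ∧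
      d = Function.update d0 q o ∧ d' = Function.update d0 q' o' := by
  rcases h with ⟨q, _, _, _, h⟩ | ⟨q, q', hne, h1, h2, h3, h4, h⟩
  · refine ⟨Function.update d q none, q, q, d q, d' q, by simp, by simp, by simp, ?_⟩
    funext r
    by_cases hr : r = q
    · subst hr; simp
    · simp [hr, h r hr]
  · refine ⟨Function.update d q none, q, q', d q, d' q', by simp, ?_, by simp, ?_⟩
    · simp [hne.symm, h3]
    · funext r
      by_cases hr' : r = q'
      · subst hr'; simp
      · by_cases hr : r = q
        · subst hr; simp [hne, h2]
        · simp [hr, hr', h r hr hr']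

section
variable {n : ℕ} {ψ : ℝ → ℝ} {γ κ₁ κ₂ : ℝ}

lemma g1_deriv (h2 : ∀ x, 0 < deriv (deriv ψ) x) (o : Option Bool) (x : ℝ) :
    HasDerivAt (g1 ψ o) (g2 ψ o x) x := by
  have h : ∀ x, HasDerivAt (deriv ψ) (deriv (deriv ψ) x) x := fun x =>
    (differentiableAt_of_deriv_ne_zero (h2 x).ne').hasDerivAt
  rcases o with _ | _ | _
  · exact hasDerivAt_const x 0
  · have := ((h (-x)).comp x (hasDerivAt_neg x)).neg
    have e : g1 ψ (some false) = -(deriv ψ ∘ Neg.neg) := by funext y; simp [g1]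
    rw [e]
    refine this.congr_deriv ?_
    simp [g2]
  · exact h x

lemma g2_nonneg (h2 : ∀ x, 0 < deriv (deriv ψ) x) (o : Option Bool) (x : ℝ) : 0 ≤ g2 ψ o x := by
  rcases o with _ | _ | _
  · exact le_rfl
  · exact (h2 _).le
  · exact (h2 _).le

lemma g2_le (hκ : 0 < κ₂) (h2 : ∀ x, deriv (deriv ψ) x < κ₂) (o : Option Bool) (x : ℝ) :
    g2 ψ o x ≤ κ₂ := by
  rcases o with _ | _ | _
  · exact hκ.le
  · exact (h2 _).le
  · exact (h2 _).le

lemma g1_le (hκ : 0 < κ₁) (h1 : ∀ x, |deriv ψ x| ≤ κ₁) (o : Option Bool) (x : ℝ) :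
    |g1 ψ o x| ≤ κ₁ := by
  rcases o with _ | _ | _
  · simpa [g1] using hκ.le
  · simpa [g1] using h1 (-x)
  · exact h1 x

lemma g1_mono (h2 : ∀ x, 0 < deriv (deriv ψ) x) (o : Option Bool) : Monotone (g1 ψ o) := by
  apply monotone_of_deriv_nonneg (fun x => (g1_deriv h2 o x).differentiableAt)
  intro x
  rw [(g1_deriv h2 o x).deriv]
  exact g2_nonneg h2 o x

open Matrix in
lemma TT_inj (hγ : 0 < γ) (h2 : ∀ x, 0 < deriv (deriv ψ) x) (d : EdgeData n) :
    Function.Injective (TT ψ γ d) := by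
  intro a b hab
  have h := congrArg (fun u => u ⬝ᵥ (a - b)) (neg_injective hab)
  simp only [add_dotProduct, sum_dotProduct, smul_dotProduct, smul_eq_mul] at h
  have h3 : ∑ q : Pair n, g1 ψ (d q) (vv q ⬝ᵥ b) * (vv q ⬝ᵥ (a - b)) ≤
      ∑ q : Pair n, g1 ψ (d q) (vv q ⬝ᵥ a) * (vv q ⬝ᵥ (a - b)) := by
    refine Finset.sum_le_sum fun q _ => ?_
    rw [dotProduct_sub]
    rcases le_total (vv q ⬝ᵥ a) (vv q ⬝ᵥ b) with hl | hl
    · have := g1_mono h2 (d q) hl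
      nlinarith
    · have := g1_mono h2 (d q) hl
      nlinarith
  have h4 : γ * ((a - b) ⬝ᵥ (a - b)) ≤ 0 := by
    rw [sub_dotProduct a b]; linarith
  have h5 : 0 ≤ (a - b) ⬝ᵥ (a - b) := Finset.sum_nonneg fun i _ => mul_self_nonneg _
  have h6 : (a - b) ⬝ᵥ (a - b) = 0 := by nlinarith
  exact sub_eq_zero.1 (dotProduct_self_eq_zero.1 h6)

open Matrix in
lemma TT_deriv (h2 : ∀ x, 0 < deriv (deriv ψ) x) (d : EdgeData n) (θ : Fin n → ℝ) :
    HasFDerivAt (TT ψ γ d) (-(Matrix.toLin' (HH ψ γ d θ)).toContinuousLinearMap) θ := by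
  have hl : ∀ q : Pair n, HasFDerivAt (fun θ : Fin n → ℝ => vv q ⬝ᵥ θ)
      (LinearMap.toContinuousLinearMap (dotProductBilin ℝ ℝ (vv q))) θ := fun q =>
    (LinearMap.toContinuousLinearMap (dotProductBilin ℝ ℝ (vv q))).hasFDerivAt
  have hs := HasFDerivAt.fun_sum (u := Finset.univ) fun (q : Pair n) _ =>
    (((g1_deriv h2 (d q) (vv q ⬝ᵥ θ)).comp_hasFDerivAt θ (hl q)).smul_const (vv q))
  have := (hs.add ((hasFDerivAt_id θ).const_smul γ)).neg
  refine this.congr_fderiv ?_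
  ext1 x
  simp [HH, PP, vecMulVec_mulVec, mul_smul]
  abel

lemma PP_psd (h2 : ∀ x, 0 < deriv (deriv ψ) x) (d : EdgeData n) (θ : Fin n → ℝ) :
    (PP ψ d θ).PosSemidef := by
  refine Matrix.posSemidef_sum _ fun q _ => ?_
  refine Matrix.PosSemidef.smul ?_ (g2_nonneg h2 _ _)
  simpa using Matrix.posSemidef_vecMulVec_self_star (vv q)

open Matrix in
lemma foc {F : ℝ → ℝ} (hsym : ∀ x, F x = 1 - F (-x)) (hψ : ψ = fun y => -Real.log (F y))
    (hd : Differentiable ℝ ψ) (d : EdgeData n) (w θ : Fin n → ℝ)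
    (hmin : IsMinOn (pobj n F γ w d) Set.univ θ) : TT ψ γ d θ = w := by
  funext i
  have hterm : ∀ o : Option Bool, ∀ x, HasDerivAt
      (fun x => o.elim 0 (fun b => nllTerm F x b)) (g1 ψ o x) x := by
    intro o x
    rcases o with _ | _ | _
    · exact hasDerivAt_const x 0
    · have h := ((hd (-x)).hasDerivAt.comp x (hasDerivAt_neg x))
      have e : (fun x => (some false).elim 0 (fun b => nllTerm F x b)) = ψ ∘ Neg.neg := by
        funext y
        have : F (-y) = 1 - F y := by rw [hsym (-y), neg_neg]
        simp [nllTerm, hψ, this]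
      rw [e]
      simpa [g1] using h
    · have e : (fun x => (some true).elim 0 (fun b => nllTerm F x b)) = ψ := by
        funext y
        simp [nllTerm, hψ]
      rw [e]
      exact (hd x).hasDerivAt
  have hline : ∀ j, HasDerivAt (fun t : ℝ => (θ + t • (Pi.single i 1 : Fin n → ℝ)) j)
      ((Pi.single i 1 : Fin n → ℝ) j) 0 := by
    intro j
    simpa using ((hasDerivAt_id (0 : ℝ)).mul_const ((Pi.single i 1 : Fin n → ℝ) j)).const_add (θ j)
  have h1 : HasDerivAt (fun t : ℝ => nll n F (θ + t • (Pi.single i 1 : Fin n → ℝ)) d)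
      (∑ q : Pair n, g1 ψ (d q) (vv q ⬝ᵥ θ) * vv q i) 0 := by
    unfold nll
    refine HasDerivAt.fun_sum fun q _ => ?_
    have hin := (hline q.1.1).sub (hline q.1.2)
    have e0 : vv q ⬝ᵥ θ = (((fun t : ℝ => (θ + t • (Pi.single i 1 : Fin n → ℝ)) q.1.1) -
        fun t : ℝ => (θ + t • (Pi.single i 1 : Fin n → ℝ)) q.1.2) : ℝ → ℝ) 0 := by
      simp [vv_dot]
    have e1 : vv q i = (Pi.single i 1 : Fin n → ℝ) q.1.1 - (Pi.single i 1 : Fin n → ℝ) q.1.2 := by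
      simp [vv, Pi.single_apply, eq_comm]
    have := (hterm (d q) (vv q ⬝ᵥ θ))
    rw [e0] at this ⊢
    rw [e1]
    exact this.comp (0 : ℝ) hin
  have h2 : HasDerivAt (fun t : ℝ => γ / 2 * ∑ j, (θ + t • (Pi.single i 1 : Fin n → ℝ)) j ^ 2)
      (γ * θ i) 0 := by
    have := (HasDerivAt.fun_sum (u := Finset.univ) fun j _ => (hline j).fun_pow 2).const_mul (γ / 2)
    refine this.congr_deriv ?_
    simp [Pi.single_apply, eq_comm]
    ring
  have h3 : HasDerivAt (fun t : ℝ => ∑ j, w j * (θ + t • (Pi.single i 1 : Fin n → ℝ)) j)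
      (w i) 0 := by
    have := (HasDerivAt.fun_sum (u := Finset.univ) fun j _ => (hline j).const_mul (w j))
    refine this.congr_deriv ?_
    simp [Pi.single_apply, eq_comm]
  have hloc : IsLocalMin (fun t : ℝ => nll n F (θ + t • (Pi.single i 1 : Fin n → ℝ)) d +
      γ / 2 * ∑ j, (θ + t • (Pi.single i 1 : Fin n → ℝ)) j ^ 2 +
      ∑ j, w j * (θ + t • (Pi.single i 1 : Fin n → ℝ)) j) 0 := by
    refine Filter.Eventually.of_forall fun t => ?_
    have := hmin (Set.mem_univ (θ + t • (Pi.single i 1 : Fin n → ℝ)))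
    simpa [pobj] using this
  have := hloc.hasDerivAt_eq_zero ((h1.add h2).add h3)
  simp only [TT, Pi.neg_apply, Pi.add_apply, Finset.sum_apply, Pi.smul_apply, smul_eq_mul]
  linarith

end

lemma law_eq {n : ℕ} {ψ : ℝ → ℝ} {γ : ℝ} (hγ : 0 < γ) (h2 : ∀ x, 0 < deriv (deriv ψ) x)
    (lam : ℝ) (d : EdgeData n) (s : (Fin n → ℝ) → (Fin n → ℝ)) (hs : Measurable s)
    (hT : ∀ w, TT ψ γ d (s w) = w) (A : Set (Fin n → ℝ)) (hA : MeasurableSet A) :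
    (laplacePi n lam).map s A = ∫⁻ θ in A, ENNReal.ofReal |(HH ψ γ d θ).det| *
      ∏ i, ENNReal.ofReal (lapDens lam (TT ψ γ d θ i)) := by
  have himg : s ⁻¹' A = TT ψ γ d '' A := by
    ext w
    constructor
    · intro h
      exact ⟨s w, h, hT w⟩
    · rintro ⟨θ, h, rfl⟩
      have : s (TT ψ γ d θ) = θ := TT_inj hγ h2 d (hT _)
      simpa [this] using h
  rw [Measure.map_apply hs hA, laplacePi_eq, withDensity_apply _ (hs hA), himg,
    lintegral_image_eq_lintegral_abs_det_fderiv_mul volume hA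
      (fun θ _ => (TT_deriv h2 d θ).hasFDerivWithinAt) (TT_inj hγ h2 d).injOn]
  refine lintegral_congr fun θ => ?_
  congr 2
  have : (-(LinearMap.toContinuousLinearMap (Matrix.toLin' (HH ψ γ d θ)))).det =
      LinearMap.det (-(Matrix.toLin' (HH ψ γ d θ))) := rfl
  rw [this, ← map_neg, LinearMap.det_toLin', Matrix.det_neg, abs_mul, abs_pow]
  simp

/-- Proposition 1: privacy of the perturbed MLE under edge DP.
If `F` satisfies (A0), (A1), (A2), the noise scale satisfies `λ ≥ 8κ₁/ε` and the ridge
penalty satisfies `γ ≥ 4κ₂/ε`, then the perturbed maximum likelihood estimator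
`θ̃(y) = argmin_θ L(θ;y) + (γ/2)‖θ‖₂² + wᵀθ`, with `w` an i.i.d. Laplace(λ) vector,
is `(ε, 0)`-edge-differentially private: for edge-adjacent datasets `d, d'` and any
measurable `A`, `P(θ̃(d) ∈ A) ≤ e^ε P(θ̃(d') ∈ A)`. The estimator is formalized as a
measurable selection `sel` of minimizers of the perturbed objective, and its law is the
pushforward of the Laplace product measure under `sel`. -/
theorem statement0 {n : ℕ} (F : ℝ → ℝ) (κ₁ κ₂ ε lam γ : ℝ)
    (hF0 : CondA0 F) (hF1 : CondA1 F κ₁) (hF2 : CondA2 F κ₂)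
    (hε : 0 < ε) (hlam : 8 * κ₁ / ε ≤ lam) (hγ : 4 * κ₂ / ε ≤ γ)
    (sel : EdgeData n → (Fin n → ℝ) → (Fin n → ℝ))
    (hmeas : ∀ d, Measurable (sel d))
    (hmin : ∀ d w, IsMinOn (pobj n F γ w d) Set.univ (sel d w)) :
    ∀ d d' : EdgeData n, EdgeAdjacent d d' →
      ∀ A : Set (Fin n → ℝ), MeasurableSet A →
        (laplacePi n lam).map (sel d) A ≤
          ENNReal.ofReal (Real.exp ε) * (laplacePi n lam).map (sel d') A := by
  intro d d' hadj A hA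
  have hpos := F_pos hF0 hF1
  obtain ⟨hmono, hsym⟩ := hF0
  obtain ⟨hκ₁, hdF, hb⟩ := hF1
  obtain ⟨hκ₂, hconv, hup, -⟩ := hF2
  set ψ : ℝ → ℝ := fun y => -Real.log (F y) with hψ
  have hγ0 : 0 < γ := lt_of_lt_of_le (by positivity) hγ
  have hl0 : 0 < lam := lt_of_lt_of_le (by positivity) hlam
  have hψd : ∀ x, HasDerivAt ψ (-(deriv F x / F x)) x := fun x =>
    ((hdF x).hasDerivAt.log (hpos x).ne').neg
  have hψ1 : ∀ x, |deriv ψ x| ≤ κ₁ := by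
    intro x
    rw [(hψd x).deriv, abs_neg]
    have h1 : 0 < 1 - F x := by have := hpos (-x); have := hsym x; linarith
    have h2 : 1 - F x < 1 := by have := hpos x; linarith
    have h3 : deriv F x / F x = deriv F x / (F x * (1 - F x)) * (1 - F x) := by
      have := (hpos x).ne'
      field_simp
    rw [h3, abs_mul, abs_of_pos h1]
    nlinarith [hb x, abs_nonneg (deriv F x / (F x * (1 - F x)))]
  have hT : ∀ d w, TT ψ γ d (sel d w) = w := fun d w =>
    foc hsym hψ (fun x => (hψd x).differentiableAt) d w _ (hmin d w)
  rw [law_eq hγ0 hconv lam d _ (hmeas d) (hT d) A hA,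
    law_eq hγ0 hconv lam d' _ (hmeas d') (hT d') A hA,
    ← lintegral_const_mul' _ _ ENNReal.ofReal_ne_top]
  refine lintegral_mono fun θ => ?_
  obtain ⟨d0, q, q', o, o', hq, hq', rfl, rfl⟩ := adj_common hadj
  have hTu : ∀ q o, d0 q = none → TT ψ γ (Function.update d0 q o) θ =
      TT ψ γ d0 θ - g1 ψ o (dotProduct (vv q) θ) • vv q := by
    intro q o hq
    unfold TT
    rw [sum_update d0 q hq o (fun r o => g1 ψ o (dotProduct (vv r) θ) • vv r) (by simp [g1])]
    abel
  have hHu : ∀ q o, d0 q = none → HH ψ γ (Function.update d0 q o) θ =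
      γ • (1 : Matrix (Fin n) (Fin n) ℝ) + PP ψ d0 θ +
        g2 ψ o (dotProduct (vv q) θ) • Matrix.vecMulVec (vv q) (vv q) := by
    intro q o hq
    unfold HH PP
    rw [sum_update d0 q hq o (fun r o => g2 ψ o (dotProduct (vv r) θ) • Matrix.vecMulVec (vv r) (vv r))
      (by simp [g2])]
    abel
  have hlap := lap_ratio n lam (ε / 2) hl0 (TT ψ γ (Function.update d0 q o) θ)
    (TT ψ γ (Function.update d0 q' o') θ) (by
      have hb1 : ∀ (q : Pair n) o, ∑ i, |g1 ψ o (dotProduct (vv q) θ) * vv q i| ≤ 2 * κ₁ := by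
        intro q o
        simp only [abs_mul]
        rw [← Finset.mul_sum, mul_comm]
        exact mul_le_mul (vv_abs q) (g1_le hκ₁ hψ1 _ _) (abs_nonneg _) (by norm_num)
      have h4 : 4 * κ₁ ≤ ε / 2 * lam := by
        rw [div_le_iff₀ hε] at hlam
        linarith
      calc _ ≤ ∑ i, (|g1 ψ o' (dotProduct (vv q') θ) * vv q' i| + |g1 ψ o (dotProduct (vv q) θ) * vv q i|) := by
            refine Finset.sum_le_sum fun i _ => ?_
            rw [hTu q o hq, hTu q' o' hq']
            simp only [Pi.sub_apply, Pi.smul_apply, smul_eq_mul]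
            refine le_trans (le_of_eq ?_) (abs_sub _ _)
            congr 1
            ring
        _ ≤ 4 * κ₁ := by
            rw [Finset.sum_add_distrib]
            linarith [hb1 q o, hb1 q' o']
        _ ≤ _ := h4)
  have hdet : |(HH ψ γ (Function.update d0 q o) θ).det| ≤
      Real.exp (ε / 2) * |(HH ψ γ (Function.update d0 q' o') θ).det| := by
    rw [hHu q o hq, hHu q' o' hq']
    obtain ⟨h1, h2, h3⟩ := det_rank_one γ _ hγ0 (g2_nonneg hconv o (dotProduct (vv q) θ)) _
      (PP_psd hconv d0 θ) (vv q)
    obtain ⟨-, h2', -⟩ := det_rank_one γ _ hγ0 (g2_nonneg hconv o' (dotProduct (vv q') θ)) _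
      (PP_psd hconv d0 θ) (vv q')
    rw [abs_of_pos (h1.trans_le h2), abs_of_pos (h1.trans_le h2')]
    refine h3.trans (mul_le_mul ?_ h2' h1.le (Real.exp_pos _).le)
    rw [vv_self]
    have h5 : g2 ψ o (dotProduct (vv q) θ) * 2 / γ ≤ ε / 2 := by
      rw [div_le_iff₀ hγ0]
      have := g2_le hκ₂ hup o (dotProduct (vv q) θ)
      rw [div_le_iff₀ hε] at hγ
      linarith
    have := Real.add_one_le_exp (ε / 2)
    linarith
  have hdet' := ENNReal.ofReal_le_ofReal hdet
  rw [ENNReal.ofReal_mul (Real.exp_pos _).le] at hdet'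
  refine (mul_le_mul' hdet' hlap).trans (le_of_eq ?_)
  have : ENNReal.ofReal (Real.exp ε) =
      ENNReal.ofReal (Real.exp (ε / 2)) * ENNReal.ofReal (Real.exp (ε / 2)) := by
    rw [← ENNReal.ofReal_mul (Real.exp_pos _).le, ← Real.exp_add, add_halves]
  rw [this]
  ring

end PrivateRanking
end

section
/- Let M be an (ε,δ)-edge-differentially-private estimator of θ taking values with ‖M(Y) − θ‖_∞ ≤ 2, where 0 < ε < 1 and p > 6 log n/n. Define for each k ∈ [n] the entrywise score attack A^{(k)}_{ij} = (M(Y)_k − θ_k)·(y_{ij} − F(θ_i−θ_j))·F′(θ_i−θ_j)/(F(θ_i−θ_j)(1−F(θ_i−θ_j))) whenever (i,j) ∈ G and either i = k or j = k (with the convention matching y_{kj} when i=k and y_{ik} when j=k), and A^{(k)}_{ij} = 0 otherwise. Then for sufficiently large n, every θ in the parameter space Θ = {θ ∈ ℝⁿ : ‖θ‖_∞ ≤ 1}, and every k ∈ [n], Σ_{1≤i<j≤n} E_{Y|θ}[A^{(k)}_{ij}] ≤ 4κ₁ n p ε · E_{Y|θ}|M(Y)_k − θ_k| + 4κ₁(n−1)δ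 + 2κ₁ n^{−1}. -/
open MeasureTheory ProbabilityTheory
open scoped ENNReal

namespace PrivateRanking

/-- Probability weight of a single pair's observation under sampling probability `p`,
when the lower-indexed item wins with probability `ρwin`. -/
noncomputable def pairWeight (p ρwin : ℝ) : Option Bool → ℝ
  | none => 1 - p
  | some true => p * ρwin
  | some false => p * (1 - ρwin)

/-- `data : Ω → EdgeData n` follows the parametric pairwise-comparison model: each pair
`(i,j)`, `i<j`, is observed independently with probability `p`, and an observed pair is
won by `i` with probability `F(θ i - θ j)`, independently across pairs. -/
def IsParamModel {Ω : Type*} [MeasurableSpace Ω] (μ : Measure Ω) (n : ℕ) (p : ℝ)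
    (F : ℝ → ℝ) (θ : Fin n → ℝ) (data : Ω → EdgeData n) : Prop :=
  Measurable data ∧
    ∀ d : EdgeData n, μ {ω | data ω = d} =
      ∏ q : Pair n, ENNReal.ofReal (pairWeight p (F (θ q.1.1 - θ q.1.2)) (d q))

/-- `W : Ω → Fin n → ℝ` is an i.i.d. Laplace(b) noise vector. -/
def IsLaplaceNoise {Ω : Type*} [MeasurableSpace Ω] (μ : Measure Ω) (n : ℕ) (b : ℝ)
    (W : Ω → Fin n → ℝ) : Prop :=
  Measurable W ∧ μ.map W = laplacePi n b

/-- The law of the comparison data under the parametric model, as an explicit finitely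
supported measure on datasets. -/
noncomputable def dataLaw (n : ℕ) (p : ℝ) (F : ℝ → ℝ) (θ : Fin n → ℝ) :
    Measure (EdgeData n) :=
  ∑ d : EdgeData n,
    (∏ q : Pair n, ENNReal.ofReal (pairWeight p (F (θ q.1.1 - θ q.1.2)) (d q))) •
      Measure.dirac d

/-- A randomized estimator (Markov kernel) is `(ε,δ)`-edge-differentially private. -/
def EdgeDP {n : ℕ} {β : Type*} [MeasurableSpace β]
    (M : Kernel (EdgeData n) β) (ε δ : ℝ) : Prop :=
  ∀ d d' : EdgeData n, EdgeAdjacent d d' → ∀ A : Set β, MeasurableSet A →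
    M d A ≤ ENNReal.ofReal (Real.exp ε) * M d' A + ENNReal.ofReal δ

/-- The contribution of the comparison on pair `q` with outcome `b` to the entrywise
score attack for coordinate `k`: nonzero only if `q` involves `k`. -/
noncomputable def scoreTerm {n : ℕ} (F : ℝ → ℝ) (θ : Fin n → ℝ) (k : Fin n)
    (z : Fin n → ℝ) (q : Pair n) (b : Bool) : ℝ :=
  if q.1.1 = k then
    (z k - θ k) * ((if b then 1 else 0) - F (θ k - θ q.1.2)) *
      (deriv F (θ k - θ q.1.2) / (F (θ k - θ q.1.2) * (1 - F (θ k - θ q.1.2))))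
  else if q.1.2 = k then
    (z k - θ k) * ((if b then 1 else 0) - F (θ q.1.1 - θ k)) *
      (deriv F (θ q.1.1 - θ k) / (F (θ q.1.1 - θ k) * (1 - F (θ q.1.1 - θ k))))
  else 0

/-- The entrywise score attack `Σ_{1≤i<j≤n} A^{(k)}_{ij}` evaluated at estimator output
`z` and dataset `d`. -/
noncomputable def scoreAttack {n : ℕ} (F : ℝ → ℝ) (θ : Fin n → ℝ) (k : Fin n)
    (d : EdgeData n) (z : Fin n → ℝ) : ℝ :=
  ∑ q : Pair n, (d q).elim 0 (fun b => scoreTerm F θ k z q b)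

theorem F_lt_one (F : ℝ → ℝ) (κ : ℝ) (hm : StrictMono F) (hs : ∀ x, F x = 1 - F (-x))
   (hk : 0 < κ) (hd : Differentiable ℝ F) (h1 : ∀ x, |deriv F x / (F x * (1 - F x))| < κ) (x : ℝ) : F x < 1 := by
  by_contra hx
  push Not at hx
  have h0 : F 0 = 1/2 := by have := hs 0; simp at this; linarith
  have hx0 : 0 < x := by
    by_contra h
    have := hm.monotone (not_lt.mp h)
    linarith
  obtain ⟨y, hy, hy1⟩ := intermediate_value_Icc hx0.le hd.continuous.continuousOn (show (1:ℝ) ∈ Set.Icc (F 0) (F x) from ⟨by linarith, hx⟩)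
  have hy0 : 0 < y := by
    rcases hy.1.lt_or_eq with h | h
    · exact h
    · rw [← h] at hy1; linarith
  have hG : ∀ t, HasDerivAt (fun t => (1 - F t) * Real.exp (κ * t)) ((-deriv F t) * Real.exp (κ * t) + (1 - F t) * (Real.exp (κ * t) * κ)) t := by
    intro t
    have a := (hd t).hasDerivAt.const_sub 1
    have b := ((hasDerivAt_id t).const_mul κ).exp
    simpa using a.fun_mul b
  have mono : MonotoneOn (fun t => (1 - F t) * Real.exp (κ * t)) (Set.Icc 0 y) := by
    apply monotoneOn_of_deriv_nonneg (convex_Icc _ _)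
    · exact fun t _ => (hG t).continuousAt.continuousWithinAt
    · exact fun t _ => (hG t).differentiableAt.differentiableWithinAt
    · intro t ht
      rw [interior_Icc] at ht
      rw [(hG t).deriv]
      have hF1 : F t < 1 := hy1 ▸ hm ht.2
      have hF0 : 1/2 < F t := h0 ▸ hm ht.1
      have := (abs_lt.mp (h1 t)).2
      have hpos : 0 < F t * (1 - F t) := mul_pos (by linarith) (by linarith)
      rw [div_lt_iff₀ hpos] at this
      have e := Real.exp_pos (κ * t)
      have : 0 ≤ κ * (1 - F t) - deriv F t := by
        have : κ * (F t * (1 - F t)) ≤ κ * (1 - F t) := by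
          apply mul_le_mul_of_nonneg_left _ hk.le; nlinarith
        linarith
      nlinarith [mul_nonneg this e.le]
  have := mono (Set.left_mem_Icc.mpr hy0.le) (Set.right_mem_Icc.mpr hy0.le) hy0.le
  simp [hy1, h0] at this
  norm_num at this

theorem dp_int {β : Type*} [MeasurableSpace β] (μ ν : Measure β) [IsProbabilityMeasure μ] [IsProbabilityMeasure ν]
   (C δ : ℝ) (hC : 0 ≤ C) (hδ : 0 ≤ δ)
   (h : ∀ A : Set β, MeasurableSet A → μ A ≤ ENNReal.ofReal C * ν A + ENNReal.ofReal δ)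
   (f : β → ℝ) (hf : Measurable f) (f0 : ∀ x, 0 ≤ f x) (hμ : ∀ᵐ x ∂μ, f x ≤ 2) (hν : ∀ᵐ x ∂ν, f x ≤ 2) :
   ∫ x, f x ∂μ ≤ C * ∫ x, f x ∂ν + 2 * δ := by
  have key : ∫⁻ x, ENNReal.ofReal (f x) ∂μ ≤ ENNReal.ofReal C * ∫⁻ x, ENNReal.ofReal (f x) ∂ν + ENNReal.ofReal (2 * δ) := by
    rw [lintegral_eq_lintegral_meas_le μ (ae_of_all _ f0) hf.aemeasurable,
      lintegral_eq_lintegral_meas_le ν (ae_of_all _ f0) hf.aemeasurable]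
    have hmeas : Measurable fun t => ν {a | t ≤ f a} := by
      apply Antitone.measurable
      intro s t hst
      exact measure_mono fun a ha => le_trans hst ha
    calc ∫⁻ t in Set.Ioi 0, μ {a | t ≤ f a} 
        ≤ ∫⁻ t in Set.Ioi 0, (ENNReal.ofReal C * ν {a | t ≤ f a} + (Set.Ioc (0:ℝ) 2).indicator (fun _ => ENNReal.ofReal δ) t) := by
          apply setLIntegral_mono' measurableSet_Ioi
          intro t ht
          by_cases h2 : t ≤ 2
          · rw [Set.indicator_of_mem (show t ∈ Set.Ioc (0:ℝ) 2 from ⟨ht, h2⟩)]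
            exact h _ (measurableSet_le measurable_const hf)
          · have : μ {a | t ≤ f a} = 0 := by
              rw [← nonpos_iff_eq_zero]
              refine le_trans (measure_mono ?_) (le_of_eq (ae_iff.mp hμ))
              intro a ha
              simp only [Set.mem_ofPred_eq] at *
              linarith
            rw [this]; exact zero_le
      _ ≤ _ := by
          rw [lintegral_add_left (hmeas.const_mul _), lintegral_const_mul _ hmeas]
          gcongr
          refine (lintegral_mono' Measure.restrict_le_self le_rfl).trans ?_
          rw [lintegral_indicator measurableSet_Ioc]
          simp
          exact (mul_comm _ _).le
  have int : ∀ (ρ : Measure β) [IsProbabilityMeasure ρ], (∀ᵐ x ∂ρ, f x ≤ 2) → Integrable f ρ := by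
    intro ρ _ hρ
    refine Integrable.of_bound hf.aestronglyMeasurable 2 ?_
    filter_upwards [hρ] with x hx
    rwa [Real.norm_of_nonneg (f0 x)]
  rw [← ofReal_integral_eq_lintegral_ofReal (int μ hμ) (ae_of_all _ f0),
    ← ofReal_integral_eq_lintegral_ofReal (int ν hν) (ae_of_all _ f0),
    ← ENNReal.ofReal_mul hC, ← ENNReal.ofReal_add (mul_nonneg hC (integral_nonneg f0)) (by positivity)] at key
  exact (ENNReal.ofReal_le_ofReal_iff (add_nonneg (mul_nonneg hC (integral_nonneg f0)) (by positivity))).mp key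

theorem dp_diff {β : Type*} [MeasurableSpace β] (μ ν : Measure β) [IsProbabilityMeasure μ] [IsProbabilityMeasure ν]
   (ε δ : ℝ) (hε : 0 < ε) (hε1 : ε < 1) (hδ : 0 ≤ δ)
   (h : ∀ A : Set β, MeasurableSet A → μ A ≤ ENNReal.ofReal (Real.exp ε) * ν A + ENNReal.ofReal δ)
   (h' : ∀ A : Set β, MeasurableSet A → ν A ≤ ENNReal.ofReal (Real.exp ε) * μ A + ENNReal.ofReal δ)
   (f : β → ℝ) (hf : Measurable f) (hμ : ∀ᵐ x ∂μ, |f x| ≤ 2) (hν : ∀ᵐ x ∂ν, |f x| ≤ 2) :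
   ∫ x, f x ∂μ - ∫ x, f x ∂ν ≤ 2 * ε * (∫ x, |f x| ∂μ + ∫ x, |f x| ∂ν) + 4 * δ := by
  have hexp : Real.exp ε ≤ 1 + 2 * ε := by
    have := Real.abs_exp_sub_one_le (x := ε) (by rw [abs_of_pos hε]; exact hε1.le)
    rw [abs_of_pos hε] at this
    have := (abs_le.mp this).2
    linarith
  have int : ∀ (ρ : Measure β) [IsProbabilityMeasure ρ], (∀ᵐ x ∂ρ, |f x| ≤ 2) → Integrable f ρ := by
    intro ρ _ hρ
    exact Integrable.of_bound hf.aestronglyMeasurable 2 hρ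
  have iμ := int μ hμ
  have iν := int ν hν
  have A := dp_int μ ν _ δ (Real.exp_pos ε).le hδ h (fun x => max (f x) 0) (hf.max measurable_const)
    (fun x => le_max_right _ _) (by filter_upwards [hμ] with x hx using max_le (abs_le.mp hx).2 (by norm_num))
    (by filter_upwards [hν] with x hx using max_le (abs_le.mp hx).2 (by norm_num))
  have B := dp_int ν μ _ δ (Real.exp_pos ε).le hδ h' (fun x => max (-f x) 0) (hf.neg.max measurable_const)
    (fun x => le_max_right _ _) (by filter_upwards [hν] with x hx using max_le (by linarith [(abs_le.mp hx).1]) (by norm_num))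
    (by filter_upwards [hμ] with x hx using max_le (by linarith [(abs_le.mp hx).1]) (by norm_num))
  have pos : ∀ (ρ : Measure β), Integrable f ρ → ∫ x, f x ∂ρ = ∫ x, max (f x) 0 ∂ρ - ∫ x, max (-f x) 0 ∂ρ ∧
     ∫ x, max (f x) 0 ∂ρ ≤ ∫ x, |f x| ∂ρ ∧ ∫ x, max (-f x) 0 ∂ρ ≤ ∫ x, |f x| ∂ρ := by
    intro ρ hρ
    have i1 : Integrable (fun x => max (f x) 0) ρ := hρ.pos_part
    have i2 : Integrable (fun x => max (-f x) 0) ρ := hρ.neg_part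
    refine ⟨?_, ?_, ?_⟩
    · rw [← integral_sub i1 i2]
      congr 1; ext x
      rcases le_total (f x) 0 with h | h
      · rw [max_eq_right h, max_eq_left (by linarith)]; ring
      · rw [max_eq_left h, max_eq_right (by linarith)]; ring
    · exact integral_mono i1 hρ.abs fun x => max_le (le_abs_self _) (abs_nonneg _)
    · exact integral_mono i2 hρ.abs fun x => max_le (neg_le_abs _) (abs_nonneg _)
  obtain ⟨e1, p1, m1⟩ := pos μ iμ
  obtain ⟨e2, p2, m2⟩ := pos ν iν
  have q2 : 0 ≤ ∫ x, max (f x) 0 ∂ν := integral_nonneg fun x => le_max_right _ _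
  have q1 : 0 ≤ ∫ x, max (-f x) 0 ∂μ := integral_nonneg fun x => le_max_right _ _
  have := mul_le_mul_of_nonneg_right hexp q1
  have := mul_le_mul_of_nonneg_right hexp q2
  have := mul_le_mul_of_nonneg_left p2 hε.le
  have := mul_le_mul_of_nonneg_left m1 hε.le
  linarith

theorem tail_num (n : ℕ) (hn : 16 ≤ n) (p : ℝ) (hp : 6 * Real.log n / n < p) :
   2 * (n : ℝ) * n * Real.exp (p * n) * Real.exp (- (2 * n * p * Real.log 2)) ≤ 1 := by
  have hn0 : (0:ℝ) < n := by positivity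
  have hl : Real.log 16 ≤ Real.log n := Real.log_le_log (by norm_num) (by exact_mod_cast hn)
  rw [show (16:ℝ) = 2 ^ 4 by norm_num, Real.log_pow] at hl
  rw [div_lt_iff₀ hn0] at hp
  have h2 := Real.log_two_gt_d9
  have e1 : (n : ℝ) = Real.exp (Real.log n) := (Real.exp_log hn0).symm
  have e2 : (2 : ℝ) = Real.exp (Real.log 2) := (Real.exp_log (by norm_num)).symm
  have : 2 * (n : ℝ) * n * Real.exp (p * n) * Real.exp (- (2 * n * p * Real.log 2)) =
     Real.exp (Real.log 2 + Real.log n + Real.log n + p * n + - (2 * n * p * Real.log 2)) := by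
    rw [Real.exp_add, Real.exp_add, Real.exp_add, Real.exp_add, ← e1, ← e2]
  rw [this, Real.exp_le_one_iff]
  push_cast at hl
  nlinarith [mul_nonneg (sub_nonneg.mpr hp.le) (show (0:ℝ) ≤ 2 * Real.log 2 - 1 by linarith), mul_nonneg (show (0:ℝ) ≤ Real.log n by linarith) (show (0:ℝ) ≤ Real.log 2 - 0.69 by linarith)]

theorem split_le {ι : Type*} [Fintype ι] [DecidableEq ι] (W : ι → Option Bool → ℝ) (hW : ∀ r o, 0 ≤ W r o) (q : ι)
    (f g : (ι → Option Bool) → ℝ)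
    (h : ∀ d, ∑ o, W q o * f (Function.update d q o) ≤ ∑ o, W q o * g (Function.update d q o)) :
    ∑ d : ι → Option Bool, (∏ r, W r (d r)) * f d ≤ ∑ d : ι → Option Bool, (∏ r, W r (d r)) * g d := by
  have key : ∀ f : (ι → Option Bool) → ℝ, ∑ d : ι → Option Bool, (∏ r, W r (d r)) * f d =
      ∑ e : {j // j ≠ q} → Option Bool, (∏ r : {j // j ≠ q}, W r (e r)) *
        ∑ o, W q o * f (Function.update ((Equiv.funSplitAt q (Option Bool)).symm (none, e)) q o) := by
    intro f
    rw [← (Equiv.funSplitAt q (Option Bool)).symm.sum_comp, Fintype.sum_prod_type, Finset.sum_comm]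
    refine Finset.sum_congr rfl fun e _ => ?_
    rw [Finset.mul_sum]
    refine Finset.sum_congr rfl fun o _ => ?_
    have h1 : (Equiv.funSplitAt q (Option Bool)).symm (o, e) =
        Function.update ((Equiv.funSplitAt q (Option Bool)).symm (none, e)) q o := by
      ext1 j
      by_cases hj : j = q
      · subst hj; simp [Equiv.funSplitAt, Equiv.piSplitAt]
      · simp [Equiv.funSplitAt, Equiv.piSplitAt, hj]
    rw [← h1, Fintype.prod_eq_mul_prod_subtype_ne _ q]
    have h2 : ∀ r : {j // j ≠ q}, (Equiv.funSplitAt q (Option Bool)).symm (o, e) r = e r := by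
      intro r; simp [Equiv.funSplitAt, Equiv.piSplitAt, r.2]
    have h3 : (Equiv.funSplitAt q (Option Bool)).symm (o, e) q = o := by
      simp [Equiv.funSplitAt, Equiv.piSplitAt]
    simp only [h2, h3]
    ring
  rw [key f, key g]
  refine Finset.sum_le_sum fun e _ => ?_
  exact mul_le_mul_of_nonneg_left (h _) (Finset.prod_nonneg fun r _ => hW _ _)

instance instDiscOB : DiscreteMeasurableSpace (Option Bool) := ⟨fun _ => trivial⟩

noncomputable def Pr (n : ℕ) (p : ℝ) (F : ℝ → ℝ) (θ : Fin n → ℝ) (d : EdgeData n) : ℝ :=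
  ∏ q : Pair n, pairWeight p (F (θ q.1.1 - θ q.1.2)) (d q)

theorem pw_nonneg (p ρ : ℝ) (hp : 0 ≤ p) (hp1 : p ≤ 1) (h0 : 0 ≤ ρ) (h1 : ρ ≤ 1) (o : Option Bool) :
    0 ≤ pairWeight p ρ o := by
  rcases o with _ | _ | _ <;> simp only [pairWeight]
  · linarith
  · exact mul_nonneg hp (by linarith)
  · exact mul_nonneg hp h0

theorem integral_law (n : ℕ) (p : ℝ) (F : ℝ → ℝ) (θ : Fin n → ℝ)
    (hw : ∀ (q : Pair n) o, 0 ≤ pairWeight p (F (θ q.1.1 - θ q.1.2)) o)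
    (M : Kernel (EdgeData n) (Fin n → ℝ)) [IsMarkovKernel M] 
    (f : EdgeData n × (Fin n → ℝ) → ℝ) (hf : Measurable f) (C : ℝ)
    (hb : ∀ d : EdgeData n, ∀ᵐ z ∂(M d), |f (d, z)| ≤ C) :
    ∫ x, f x ∂((dataLaw n p F θ).compProd M) = ∑ d, Pr n p F θ d * ∫ z, f (d, z) ∂(M d) := by
  have hfin : IsFiniteMeasure (dataLaw n p F θ) := by
    constructor
    unfold dataLaw
    simp only [Measure.coe_finsetSum, Finset.sum_apply, Measure.smul_apply, smul_eq_mul]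
    refine ENNReal.sum_lt_top.mpr fun d _ => ENNReal.mul_lt_top (ENNReal.prod_lt_top fun q _ => ENNReal.ofReal_lt_top) (measure_lt_top _ _)
  have hint : Integrable f ((dataLaw n p F θ).compProd M) := by
    refine Integrable.of_bound hf.aestronglyMeasurable C ?_
    apply Measure.ae_compProd_of_ae_ae
    · exact measurableSet_le hf.norm measurable_const
    · exact ae_of_all _ hb
  rw [Measure.integral_compProd hint]
  unfold dataLaw
  rw [integral_finsetSum_measure]
  · refine Finset.sum_congr rfl fun d _ => ?_
    rw [integral_smul_measure, integral_dirac, smul_eq_mul, ENNReal.toReal_prod]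
    congr 1
    exact Finset.prod_congr rfl fun q _ => ENNReal.toReal_ofReal (hw _ _)
  · intro d _
    exact (integrable_dirac (by simp)).smul_measure (ENNReal.prod_lt_top fun q _ => ENNReal.ofReal_lt_top).ne

/-- coefficient -/
noncomputable def coef {n : ℕ} (F : ℝ → ℝ) (θ : Fin n → ℝ) (q : Pair n) (b : Bool) : ℝ :=
  ((if b then 1 else 0) - F (θ q.1.1 - θ q.1.2)) *
      (deriv F (θ q.1.1 - θ q.1.2) / (F (θ q.1.1 - θ q.1.2) * (1 - F (θ q.1.1 - θ q.1.2))))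

def inc {n : ℕ} (k : Fin n) : Finset (Pair n) := Finset.univ.filter fun q => q.1.1 = k ∨ q.1.2 = k

theorem score_eq {n : ℕ} (F : ℝ → ℝ) (θ : Fin n → ℝ) (k : Fin n) (d : EdgeData n) (z : Fin n → ℝ) :
    scoreAttack F θ k d z = ∑ q ∈ inc k, (d q).elim 0 (coef F θ q) * (z k - θ k) := by
  unfold scoreAttack inc
  rw [Finset.sum_filter]
  refine Finset.sum_congr rfl fun q _ => ?_
  unfold scoreTerm coef
  by_cases h1 : q.1.1 = k
  · cases hd : d q with
    | none => simp
    | some b => simp only [Option.elim, h1, if_true, true_or]; ring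
  · by_cases h2 : q.1.2 = k
    · cases hd : d q with
      | none => simp
      | some b => simp only [Option.elim, h1, h2, if_true, if_false, or_true]; ring
    · cases hd : d q <;> simp [h1, h2]

theorem card_inc {n : ℕ} (k : Fin n) : (inc k).card ≤ n - 1 := by
  have : (inc k).card ≤ (Finset.univ.erase k).card := by
    apply Finset.card_le_card_of_injOn (fun q : Pair n => if q.1.1 = k then q.1.2 else q.1.1)
    · rintro ⟨⟨a, b⟩, hab⟩ hq
      simp only [inc, Finset.coe_filter, Finset.mem_univ, true_and, Set.mem_ofPred_eq] at hq hab
      simp only [Finset.coe_erase, Set.mem_sdiff, Finset.coe_univ, Set.mem_univ, true_and, Set.mem_singleton_iff]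
      split_ifs with h
      · rintro rfl; exact absurd hab (by simp [h])
      · exact h
    · rintro ⟨⟨a, b⟩, hab⟩ hq ⟨⟨a', b'⟩, hab'⟩ hq' h
      simp only [inc, Finset.coe_filter, Finset.mem_univ, true_and, Set.mem_ofPred_eq] at hq hab hq' hab' h
      simp only [Subtype.mk.injEq, Prod.mk.injEq]
      grind
  simpa using this

theorem single_edge (x p s κ ε δ mT mF aT aF : ℝ) (hx0 : 0 < x) (hx1 : x < 1) (hp : 0 ≤ p) (hs : 0 ≤ s) (hsk : s ≤ κ)
    (hε : 0 < ε) (hδ : 0 ≤ δ) (haT : 0 ≤ aT) (haF : 0 ≤ aF) (h : mT - mF ≤ 2 * ε * (aT + aF) + 4 * δ) :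
    p * x * ((1 - x) * s * mT) + p * (1 - x) * ((0 - x) * s * mF) ≤
    p * x * (κ * (2 * ε * aT + 4 * δ)) + p * (1 - x) * (κ * (2 * ε * aF + 4 * δ)) := by
  have hy : 0 < 1 - x := by linarith
  have hκ : 0 ≤ κ := hs.trans hsk
  have e : p * x * ((1 - x) * s * mT) + p * (1 - x) * ((0 - x) * s * mF) = (p * x * (1 - x)) * (s * (mT - mF)) := by ring
  rw [e]
  calc (p * x * (1 - x)) * (s * (mT - mF)) ≤ (p * x * (1 - x)) * (κ * (2 * ε * (aT + aF) + 4 * δ)) := by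
        apply mul_le_mul_of_nonneg_left _ (by positivity)
        calc s * (mT - mF) ≤ s * (2 * ε * (aT + aF) + 4 * δ) := mul_le_mul_of_nonneg_left h hs
          _ ≤ _ := mul_le_mul_of_nonneg_right hsk (by positivity)
    _ ≤ _ := by
      have t1 : p * x * (κ * (2 * ε * aT)) * (1 - x) ≤ p * x * (κ * (2 * ε * aT)) :=
        mul_le_of_le_one_right (by positivity) (by linarith)
      have t2 : p * (1 - x) * (κ * (2 * ε * aF)) * x ≤ p * (1 - x) * (κ * (2 * ε * aF)) :=
        mul_le_of_le_one_right (by positivity) hx1.le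
      have t3 : p * κ * 4 * δ * (x * (1 - x)) ≤ p * κ * 4 * δ :=
        mul_le_of_le_one_right (by positivity) (by nlinarith)
      linarith

theorem deg_ptwise (D : ℕ) (n : ℕ) (hD : D ≤ n) (y : ℝ) :
    (D : ℝ) ≤ y + n * ((2:ℝ) ^ D * Real.exp (-(y * Real.log 2))) ∨ y < 0 := by
  by_cases hy : y < 0
  · right; exact hy
  left
  push Not at hy
  by_cases h : (D : ℝ) ≤ y
  · have : 0 ≤ n * ((2:ℝ) ^ D * Real.exp (-(y * Real.log 2))) := by positivity
    linarith
  · push Not at h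
    have e : (2:ℝ) ^ D = Real.exp (D * Real.log 2) := by
      rw [Real.exp_nat_mul, Real.exp_log (by norm_num)]
    have : 1 ≤ (2:ℝ) ^ D * Real.exp (-(y * Real.log 2)) := by
      rw [e, ← Real.exp_add, Real.one_le_exp_iff]
      nlinarith [Real.log_two_gt_d9]
    have h2 : (n:ℝ) * 1 ≤ n * ((2:ℝ) ^ D * Real.exp (-(y * Real.log 2))) := mul_le_mul_of_nonneg_left this (by positivity)
    have : (D:ℝ) ≤ n := by exact_mod_cast hD
    linarith

theorem sum_Pr (n : ℕ) (p : ℝ) (F : ℝ → ℝ) (θ : Fin n → ℝ) : ∑ d, Pr n p F θ d = 1 := by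
  unfold Pr
  rw [← Fintype.prod_sum (fun (q : Pair n) o => pairWeight p (F (θ q.1.1 - θ q.1.2)) o)]
  apply Finset.prod_eq_one
  intro q _
  rw [Fintype.sum_option, Fintype.sum_bool]
  simp only [pairWeight]
  ring

def dg {n : ℕ} (k : Fin n) (d : EdgeData n) : ℕ := ((inc k).filter fun q => (d q).isSome).card

theorem mgf_dg (n : ℕ) (p : ℝ) (hp : 0 ≤ p) (F : ℝ → ℝ) (θ : Fin n → ℝ) (k : Fin n) :
    ∑ d, Pr n p F θ d * 2 ^ dg k d ≤ Real.exp (p * n) := by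
  have e : ∀ d : EdgeData n, Pr n p F θ d * 2 ^ dg k d =
      ∏ q : Pair n, (pairWeight p (F (θ q.1.1 - θ q.1.2)) (d q) * if q ∈ inc k ∧ (d q).isSome then 2 else 1) := by
    intro d
    rw [Finset.prod_mul_distrib]
    unfold Pr dg
    congr 1
    rw [Finset.prod_ite]
    simp only [Finset.prod_const, one_pow, mul_one]
    congr 2
    ext q; simp
  simp only [e]
  rw [← Fintype.prod_sum (fun (q : Pair n) o => pairWeight p (F (θ q.1.1 - θ q.1.2)) o * if q ∈ inc k ∧ o.isSome then (2:ℝ) else 1)]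
  have e2 : ∀ q : Pair n, ∑ o, pairWeight p (F (θ q.1.1 - θ q.1.2)) o * (if q ∈ inc k ∧ o.isSome then (2:ℝ) else 1) =
      if q ∈ inc k then 1 + p else 1 := by
    intro q
    rw [Fintype.sum_option, Fintype.sum_bool]
    by_cases h : q ∈ inc k <;> simp [pairWeight, h] <;> ring
  simp only [e2]
  rw [Finset.prod_ite]
  simp only [Finset.prod_const, one_pow, mul_one]
  have hc : (Finset.univ.filter fun q => q ∈ inc k).card ≤ n := by
    have : (Finset.univ.filter fun q => q ∈ inc k) = inc k := by ext q; simp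
    rw [this]
    have := card_inc k
    omega
  calc (1 + p) ^ _ ≤ (1 + p) ^ n := pow_le_pow_right₀ (by linarith) hc
    _ ≤ (Real.exp p) ^ n := by
      gcongr
      have := Real.add_one_le_exp p; linarith
    _ = _ := by rw [← Real.exp_nat_mul, mul_comm]

/-- Proposition 3: soundness of the entrywise score attack.
Let `M` be an `(ε,δ)`-edge-DP randomized estimator whose output always satisfies
`‖M(Y) - θ‖_∞ ≤ 2`, with `0 < ε < 1` and `p > 6 log n / n`.  Then for sufficiently
large `n`, every `θ` with `‖θ‖_∞ ≤ 1` and every `k`,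
`Σ_{i<j} E[A^{(k)}_{ij}] ≤ 4κ₁ n p ε E|M(Y)_k - θ_k| + 4κ₁(n-1)δ + 2κ₁/n`,
where the expectation is over the data `Y ∼ dataLaw` and the randomness of `M`. -/
theorem statement4 (F : ℝ → ℝ) (κ₁ : ℝ) (hF0 : CondA0 F) (hF1 : CondA1 F κ₁) :
    ∃ N : ℕ, ∀ n : ℕ, N ≤ n →
    ∀ (p ε δ : ℝ) (θ : Fin n → ℝ),
      0 < ε → ε < 1 → 0 ≤ δ → (∀ i, |θ i| ≤ 1) →
      6 * Real.log n / n < p → p ≤ 1 →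
    ∀ (M : Kernel (EdgeData n) (Fin n → ℝ)), IsMarkovKernel M →
      EdgeDP M ε δ →
      (∀ d : EdgeData n, ∀ᵐ z ∂(M d), ∀ i, |z i - θ i| ≤ 2) →
      ∀ k : Fin n,
        ∫ x, scoreAttack F θ k x.1 x.2 ∂((dataLaw n p F θ).compProd M) ≤
          4 * κ₁ * n * p * ε *
              ∫ x, |x.2 k - θ k| ∂((dataLaw n p F θ).compProd M) +
            4 * κ₁ * ((n : ℝ) - 1) * δ + 2 * κ₁ / n := by
  obtain ⟨hmono, hsym⟩ := hF0
  obtain ⟨hκ, hdiff, hbd⟩ := hF1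
  have hFlt := F_lt_one F κ₁ hmono hsym hκ hdiff hbd
  have hFpos : ∀ x, 0 < F x := fun x => by have := hsym x; have := hFlt (-x); linarith
  refine ⟨16, ?_⟩
  intro n hn p ε δ θ hε hε1 hδ hθ hp hp1 M hM hDP hB k
  have hn0 : (0:ℝ) < n := by have : 0 < n := by omega
                             exact_mod_cast this
  have hp0 : 0 ≤ p := by
    refine le_trans ?_ hp.le
    have : 0 ≤ Real.log n := Real.log_natCast_nonneg n
    positivity
  have htail := tail_num n hn p hp
  have hw : ∀ (q : Pair n) o, 0 ≤ pairWeight p (F (θ q.1.1 - θ q.1.2)) o := fun q o =>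
    pw_nonneg _ _ hp0 hp1 (hFpos _).le (hFlt _).le o
  have hPr : ∀ d, 0 ≤ Pr n p F θ d := fun d => Finset.prod_nonneg fun q _ => hw _ _
  have hX : Measurable fun z : Fin n → ℝ => z k - θ k := (measurable_pi_apply k).sub measurable_const
  have hBk : ∀ d : EdgeData n, ∀ᵐ z ∂(M d), |z k - θ k| ≤ 2 := fun d => by
    filter_upwards [hB d] with z hz using hz k
  have hcM : ∀ q : Pair n, Measurable fun d : EdgeData n => (d q).elim 0 (coef F θ q) := fun q =>
    (measurable_of_countable fun o : Option Bool => o.elim 0 (coef F θ q)).comp (measurable_pi_apply q)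
  have I2 := integral_law n p F θ hw M (fun x => |x.2 k - θ k|)
    ((hX.comp measurable_snd).abs) 2 (fun d => by filter_upwards [hBk d] with z hz; simpa using hz)
  obtain ⟨C, hC⟩ : ∃ C, ∀ d : EdgeData n, |∑ q ∈ inc k, (d q).elim 0 (coef F θ q)| ≤ C := by
    obtain ⟨C, hC⟩ := (Set.finite_range fun d : EdgeData n => |∑ q ∈ inc k, (d q).elim 0 (coef F θ q)|).bddAbove
    exact ⟨C, fun d => hC ⟨d, rfl⟩⟩
  have I1 := integral_law n p F θ hw M (fun x => scoreAttack F θ k x.1 x.2)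
    (by
      simp only [score_eq]
      exact Finset.measurable_sum _ fun q _ => ((hcM q).comp measurable_fst).mul (hX.comp measurable_snd)) (C * 2)
    (fun d => by
      filter_upwards [hBk d] with z hz
      simp only [score_eq]
      rw [← Finset.sum_mul, abs_mul]
      exact mul_le_mul (hC d) hz (abs_nonneg _) ((abs_nonneg _).trans (hC d)))
  rw [I1, I2]
  simp only [score_eq]
  set m : EdgeData n → ℝ := fun d => ∫ z, (z k - θ k) ∂(M d) with hm
  set a : EdgeData n → ℝ := fun d => ∫ z, |z k - θ k| ∂(M d) with ha
  have ha0 : ∀ d, 0 ≤ a d := fun d => integral_nonneg fun z => abs_nonneg _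
  have hint : ∀ d, Integrable (fun z : Fin n → ℝ => z k - θ k) (M d) := fun d =>
    Integrable.of_bound hX.aestronglyMeasurable 2 (hBk d)
  have ha2 : ∀ d, a d ≤ 2 := fun d => by
    have := integral_mono_ae (hint d).abs (integrable_const (2:ℝ)) (hBk d)
    simpa using this
  have hS : ∀ d : EdgeData n, ∫ z, ∑ q ∈ inc k, (d q).elim 0 (coef F θ q) * (z k - θ k) ∂(M d) =
      ∑ q ∈ inc k, (d q).elim 0 (coef F θ q) * m d := by
    intro d
    rw [integral_finsetSum _ fun q _ => (hint d).const_mul _]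
    exact Finset.sum_congr rfl fun q _ => integral_const_mul _ _
  simp only [hS, Finset.mul_sum]
  rw [Finset.sum_comm]
  have edge : ∀ q ∈ inc k, ∑ d, Pr n p F θ d * ((d q).elim 0 (coef F θ q) * m d) ≤
      ∑ d, Pr n p F θ d * (if (d q).isSome then κ₁ * (2 * ε * a d + 4 * δ) else 0) := by
    intro q _
    apply split_le (fun (q : Pair n) o => pairWeight p (F (θ q.1.1 - θ q.1.2)) o) hw q
      (fun d => (d q).elim 0 (coef F θ q) * m d)
      (fun d => if (d q).isSome then κ₁ * (2 * ε * a d + 4 * δ) else 0)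
    intro d
    rw [Fintype.sum_option, Fintype.sum_bool, Fintype.sum_option, Fintype.sum_bool]
    simp only [Function.update_self, Option.elim, coef, pairWeight, Option.isSome_some, Option.isSome_none,
      zero_mul, mul_zero, zero_add, if_true, Bool.false_eq_true, if_false]
    set x := F (θ q.1.1 - θ q.1.2) with hx
    have hx0 : 0 < x := hFpos _
    have hx1 : x < 1 := hFlt _
    have adj : ∀ b b' : Bool, b ≠ b' → EdgeAdjacent (Function.update d q (some b)) (Function.update d q (some b')) := by
      intro b b' hb
      refine Or.inl ⟨q, by simp, by simp, by simpa using hb, fun r hr => by simp [hr]⟩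
    apply single_edge x p _ κ₁ ε δ _ _ _ _ hx0 hx1 hp0 _ _ hε hδ (ha0 _) (ha0 _)
    · exact dp_diff _ _ ε δ hε hε1 hδ (hDP _ _ (adj true false (by simp))) (hDP _ _ (adj false true (by simp))) _ hX (hBk _) (hBk _)
    · exact div_nonneg hmono.monotone.deriv_nonneg (mul_nonneg hx0.le (by linarith))
    · exact (le_abs_self _).trans (hbd _).le
  refine (Finset.sum_le_sum edge).trans ?_
  rw [Finset.sum_comm]
  have hcard : ∀ d, dg k d ≤ n - 1 := fun d => (Finset.card_filter_le _ _).trans (card_inc k)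
  have hcardR : ∀ d, (dg k d : ℝ) ≤ n - 1 := fun d => by
    have h1 : ((n - 1 : ℕ) : ℝ) = n - 1 := by rw [Nat.cast_sub (by omega)]; simp
    rw [← h1]; exact_mod_cast hcard d
  set E := Real.exp (-(2 * n * p * Real.log 2)) with hE
  have pt : ∀ d : EdgeData n, ∑ q ∈ inc k, Pr n p F θ d * (if (d q).isSome then κ₁ * (2 * ε * a d + 4 * δ) else 0) ≤
      4 * κ₁ * n * p * ε * (Pr n p F θ d * a d) + 4 * κ₁ * ((n:ℝ) - 1) * δ * Pr n p F θ d
        + 4 * κ₁ * n * E * (Pr n p F θ d * 2 ^ dg k d) := by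
    intro d
    rw [← Finset.mul_sum, ← Finset.sum_filter, Finset.sum_const, nsmul_eq_mul]
    change Pr n p F θ d * ((dg k d : ℝ) * _) ≤ _
    have h1 : (dg k d : ℝ) ≤ 2 * n * p + n * ((2:ℝ) ^ dg k d * E) := by
      rcases deg_ptwise (dg k d) n ((hcard d).trans (Nat.sub_le _ _)) (2 * n * p) with h | h
      · exact h
      · exact absurd h (not_lt.mpr (by positivity))
    have h2 : (dg k d : ℝ) * (κ₁ * (2 * ε * a d + 4 * δ)) ≤
        4 * κ₁ * n * p * ε * a d + 4 * κ₁ * ((n:ℝ) - 1) * δ + 4 * κ₁ * n * E * 2 ^ dg k d := by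
      have t1 := mul_le_mul_of_nonneg_right (hcardR d) (show 0 ≤ 4 * κ₁ * δ by positivity)
      have t2 := mul_le_mul_of_nonneg_right h1 (show 0 ≤ 2 * κ₁ * ε * a d by have := ha0 d; positivity)
      have hea : ε * a d ≤ 2 := by nlinarith [ha0 d, ha2 d]
      have t3 := mul_le_mul_of_nonneg_left hea (show 0 ≤ 2 * κ₁ * (n * ((2:ℝ) ^ dg k d * E)) by positivity)
      nlinarith
    have := mul_le_mul_of_nonneg_left h2 (hPr d)
    linarith
  refine (Finset.sum_le_sum fun d _ => pt d).trans ?_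
  rw [Finset.sum_add_distrib, Finset.sum_add_distrib, ← Finset.mul_sum, ← Finset.mul_sum, ← Finset.mul_sum, sum_Pr]
  have hmg := mgf_dg n p hp0 F θ k
  have hlast : 4 * κ₁ * n * E * ∑ d, Pr n p F θ d * 2 ^ dg k d ≤ 2 * κ₁ / n := by
    calc _ ≤ 4 * κ₁ * n * E * Real.exp (p * n) := mul_le_mul_of_nonneg_left hmg (by positivity)
      _ ≤ _ := by
        rw [le_div_iff₀ hn0]
        have := mul_le_mul_of_nonneg_left htail (show 0 ≤ 2 * κ₁ by positivity)
        linarith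
  linarith

end PrivateRanking
end

section
/- Let N_i = Σ_{j≠i, (i,j)∈G} 1(Y_{ij} = 1) be the number of comparisons won by item i, let W₁,…,W_n be i.i.d. Laplace(2/ε) random variables, and let S̃_k be the index set of the k largest values among {N_i + W_i}_{i∈[n]}. For every k ∈ [n−1], every tolerance m with 0 ≤ m ≤ min(k−1, n−k−1), and any sufficiently large constant C > 0, sup_{ρ ∈ Θ(k,m,C)} P( d_H(S̃_k, S_k) > 2m ) < O(n^{−5}), where Θ(k,m,C) = {ρ ∈ [0,1]^{n×n} : ρ + ρᵀ = 11ᵀ, τ_{(k−m)} − τ_{(k+m+1)} ≥ C(√(log n/(np)) + log n/(npε))}. -/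
open MeasureTheory ProbabilityTheory
open scoped ENNReal

namespace PrivateRanking

/-- The average winning probability `τ_i = (1/n) Σ_j ρ_{ij}`. -/
noncomputable def tau (n : ℕ) (ρ : Fin n → Fin n → ℝ) (i : Fin n) : ℝ := (∑ j, ρ i j) / n

/-- The number `N_i` of comparisons won by item `i` in the dataset `d`. -/
def wins {n : ℕ} (d : EdgeData n) (i : Fin n) : ℕ :=
  (Finset.univ.filter fun q : Pair n =>
    (q.1.1 = i ∧ d q = some true) ∨ (q.1.2 = i ∧ d q = some false)).card

/-- `data : Ω → EdgeData n` follows the nonparametric pairwise-comparison model with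
pairwise probability matrix `ρ`: each pair `(i,j)`, `i<j`, is observed independently
with probability `p`, and an observed pair is won by `i` with probability `ρ i j`. -/
def IsNPModel {Ω : Type*} [MeasurableSpace Ω] (μ : Measure Ω) (n : ℕ) (p : ℝ)
    (ρ : Fin n → Fin n → ℝ) (data : Ω → EdgeData n) : Prop :=
  Measurable data ∧
    ∀ d : EdgeData n, μ {ω | data ω = d} =
      ∏ q : Pair n, ENNReal.ofReal (pairWeight p (ρ q.1.1 q.1.2) (d q))

lemma laplace_Iic (b c : ℝ) (hb : 0 < b) (hc : c ≤ 0) :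
    laplaceMeasure b (Set.Iic c) = ENNReal.ofReal (Real.exp (c / b) / 2) := by
  unfold laplaceMeasure
  rw [withDensity_apply _ measurableSet_Iic]
  have h1 : ∫⁻ x in Set.Iic c, ENNReal.ofReal ((2 * b)⁻¹ * Real.exp (-|x| / b))
      = ∫⁻ x in Set.Iic c, ENNReal.ofReal ((2 * b)⁻¹ * Real.exp (b⁻¹ * x)) := by
    refine setLIntegral_congr_fun measurableSet_Iic ?_
    intro x hx
    have hx' : x ≤ 0 := le_trans hx hc
    have : -|x| / b = b⁻¹ * x := by rw [abs_of_nonpos hx']; field_simp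
    simp only [this]
  rw [h1, ← ofReal_integral_eq_lintegral_ofReal, integral_const_mul,
    integral_exp_mul_Iic (inv_pos.2 hb)]
  · congr 1
    have : b⁻¹ * c = c / b := by field_simp
    rw [this]; field_simp
  · exact (integrableOn_exp_mul_Iic (inv_pos.2 hb) c).const_mul _
  · exact Filter.Eventually.of_forall fun x => by positivity

lemma laplace_Ioi (b c : ℝ) (hb : 0 < b) (hc : 0 ≤ c) :
    laplaceMeasure b (Set.Ioi c) = ENNReal.ofReal (Real.exp (-c / b) / 2) := by
  unfold laplaceMeasure
  rw [withDensity_apply _ measurableSet_Ioi]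
  have hb' : -b⁻¹ < 0 := neg_lt_zero.2 (inv_pos.2 hb)
  have h1 : ∫⁻ x in Set.Ioi c, ENNReal.ofReal ((2 * b)⁻¹ * Real.exp (-|x| / b))
      = ∫⁻ x in Set.Ioi c, ENNReal.ofReal ((2 * b)⁻¹ * Real.exp (-b⁻¹ * x)) := by
    refine setLIntegral_congr_fun measurableSet_Ioi ?_
    intro x hx
    have hx' : 0 ≤ x := le_trans hc (le_of_lt hx)
    have : -|x| / b = -b⁻¹ * x := by rw [abs_of_nonneg hx']; field_simp
    simp only [this]
  rw [h1, ← ofReal_integral_eq_lintegral_ofReal, integral_const_mul,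
    integral_exp_mul_Ioi hb']
  · congr 1
    have : -b⁻¹ * c = -c / b := by field_simp
    rw [this]; field_simp
  · exact (integrableOn_exp_mul_Ioi hb' c).const_mul _
  · exact Filter.Eventually.of_forall fun x => by positivity

lemma laplace_prob (b : ℝ) (hb : 0 < b) : IsProbabilityMeasure (laplaceMeasure b) := by
  constructor
  rw [← Set.Iic_union_Ioi (a := (0:ℝ)), measure_union (Set.Iic_disjoint_Ioi le_rfl) measurableSet_Ioi,
    laplace_Iic b 0 hb le_rfl, laplace_Ioi b 0 hb le_rfl, ← ENNReal.ofReal_add (by positivity) (by positivity)]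
  norm_num

lemma laplace_tail (b t : ℝ) (hb : 0 < b) (ht : 0 ≤ t) :
    laplaceMeasure b {x | t < |x|} ≤ ENNReal.ofReal (Real.exp (-t / b)) := by
  have hsub : {x : ℝ | t < |x|} ⊆ Set.Iic (-t) ∪ Set.Ioi t := by
    intro x hx
    rcases lt_abs.1 (show t < |x| from hx) with h | h
    · exact Or.inr h
    · left; simp only [Set.mem_Iic]; linarith
  refine (measure_mono hsub).trans ((measure_union_le _ _).trans ?_)
  rw [laplace_Iic b (-t) hb (by linarith), laplace_Ioi b t hb ht,
    ← ENNReal.ofReal_add (by positivity) (by positivity)]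
  apply ENNReal.ofReal_le_ofReal
  linarith

lemma noise_tail {Ω : Type} [MeasurableSpace Ω] (μ : Measure Ω) (n : ℕ) (b t : ℝ) (hb : 0 < b)
    (ht : 0 ≤ t) (W : Ω → Fin n → ℝ) (hW : IsLaplaceNoise μ n b W) (i : Fin n) :
    μ {ω | t < |W ω i|} ≤ ENNReal.ofReal (Real.exp (-t / b)) := by
  have := laplace_prob b hb
  have hms : MeasurableSet {x : ℝ | t < |x|} := measurableSet_lt measurable_const measurable_abs
  have h1 : μ {ω | t < |W ω i|} = (μ.map W) (Function.eval i ⁻¹' {x : ℝ | t < |x|}) := by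
    rw [Measure.map_apply hW.1 (measurable_pi_apply i hms)]
    rfl
  rw [h1, hW.2]
  unfold laplacePi
  rw [(measurePreserving_eval (fun _ : Fin n => laplaceMeasure b) i).measure_preimage
    hms.nullMeasurableSet]
  exact laplace_tail b t hb ht

/-- the probability that `i` wins the comparison `q` given observed -/
noncomputable def rwin {n : ℕ} (ρ : Fin n → Fin n → ℝ) (i : Fin n) (q : Pair n) : ℝ :=
  (if q.1.1 = i then ρ i q.1.2 else 0) + (if q.1.2 = i then ρ i q.1.1 else 0)

lemma sum_rwin {n : ℕ} (ρ : Fin n → Fin n → ℝ) (i : Fin n) :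
    ∑ q : Pair n, rwin ρ i q = ∑ j, ρ i j - ρ i i := by
  have h := Finset.sum_subtype (F := inferInstance) (p := fun q : Fin n × Fin n => q.1 < q.2)
    (Finset.univ.filter fun q : Fin n × Fin n => q.1 < q.2) (by simp)
    (fun q : Fin n × Fin n => (if q.1 = i then ρ i q.2 else 0) + (if q.2 = i then ρ i q.1 else 0))
  unfold rwin
  rw [← h, Finset.sum_filter, Fintype.sum_prod_type]
  have h2 : ∀ x y : Fin n, (if x < y then (if x = i then ρ i y else 0) +
      (if y = i then ρ i x else 0) else 0) = (if x = i then (if i < y then ρ i y else 0) else 0) +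
      (if y = i then (if x < i then ρ i x else 0) else 0) := by
    intro x y
    split_ifs <;> simp_all
  simp only [h2, Finset.sum_add_distrib]
  have h3 : ∑ x : Fin n, ∑ y : Fin n, (if x = i then (if i < y then ρ i y else 0) else 0) =
      ∑ y : Fin n, (if i < y then ρ i y else 0) := by
    rw [Finset.sum_comm]
    simp
  rw [h3]
  simp only [Finset.sum_ite_eq', Finset.mem_univ, if_true]
  rw [← Finset.sum_add_distrib, eq_sub_iff_add_eq]
  have h4 : ρ i i = ∑ x : Fin n, if x = i then ρ i i else 0 := by simp
  rw [h4, ← Finset.sum_add_distrib]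
  refine Finset.sum_congr rfl fun x _ => ?_
  rcases lt_trichotomy x i with h | h | h
  · simp [h, h.ne, h.not_gt]
  · simp [h]
  · simp [h, h.ne', h.not_gt]

/-- indicator that `i` wins `q` -/
noncomputable def winInd {n : ℕ} (i : Fin n) (q : Pair n) (o : Option Bool) : ℝ :=
  if (q.1.1 = i ∧ o = some true) ∨ (q.1.2 = i ∧ o = some false) then 1 else 0

lemma wins_eq {n : ℕ} (d : EdgeData n) (i : Fin n) :
    (wins d i : ℝ) = ∑ q : Pair n, winInd i q (d q) := by
  unfold wins winInd
  simp

lemma mgf_pair {n : ℕ} (p l : ℝ) (ρ : Fin n → Fin n → ℝ)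
    (hs : ∀ i j, ρ i j + ρ j i = 1) (i : Fin n) (q : Pair n) :
    ∑ o : Option Bool, pairWeight p (ρ q.1.1 q.1.2) o * Real.exp (l * winInd i q o) ≤
      Real.exp (p * rwin ρ i q * (Real.exp l - 1)) := by
  have hq : q.1.1 ≠ q.1.2 := q.2.ne
  refine le_trans (le_of_eq ?_) (Real.add_one_le_exp _)
  rw [Fintype.sum_option, Fintype.sum_bool]
  unfold winInd rwin
  by_cases h1 : q.1.1 = i
  · have h2 : q.1.2 ≠ i := fun h => hq (h1.trans h.symm)
    simp [h1, h2, pairWeight]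
    ring
  · by_cases h2 : q.1.2 = i
    · have h3 : ρ q.1.1 i = 1 - ρ i q.1.1 := by linarith [hs i q.1.1]
      simp [h1, h2, pairWeight, h3]
      ring
    · simp [h1, h2, pairWeight]
      ring

lemma data_markov {Ω : Type} [MeasurableSpace Ω] (μ : Measure Ω) (n : ℕ) (p : ℝ)
    (ρ : Fin n → Fin n → ℝ) (data : Ω → EdgeData n) (hp : 0 < p) (hp1 : p ≤ 1)
    (h0 : ∀ i j, 0 ≤ ρ i j) (hs : ∀ i j, ρ i j + ρ j i = 1) (hd : IsNPModel μ n p ρ data)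
    (i : Fin n) (l a : ℝ) :
    μ {ω | a ≤ l * (wins (data ω) i : ℝ)} ≤
      ENNReal.ofReal (Real.exp (p * (∑ j, ρ i j - ρ i i) * (Real.exp l - 1) - a)) := by
  classical
  have hw : ∀ (q : Pair n) o, 0 ≤ pairWeight p (ρ q.1.1 q.1.2) o := by
    intro q o
    have h1 := h0 q.1.1 q.1.2
    have h2 := h0 q.1.2 q.1.1
    have h3 := hs q.1.1 q.1.2
    rcases o with _ | _ | _
    · simp only [pairWeight]; linarith
    · simp only [pairWeight]; exact mul_nonneg hp.le (by linarith)
    · simp only [pairWeight]; exact mul_nonneg hp.le (by linarith)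
  have hsub : {ω | a ≤ l * (wins (data ω) i : ℝ)} ⊆
      ⋃ d ∈ Finset.univ.filter (fun d : EdgeData n => a ≤ l * (wins d i : ℝ)),
        {ω | data ω = d} := by
    intro ω hω
    simp only [Set.mem_iUnion]
    exact ⟨data ω, by simpa using hω, rfl⟩
  refine (measure_mono hsub).trans ((measure_biUnion_finset_le _ _).trans ?_)
  have hdd : ∀ d : EdgeData n, μ {ω | data ω = d} =
      ENNReal.ofReal (∏ q : Pair n, pairWeight p (ρ q.1.1 q.1.2) (d q)) := by
    intro d
    rw [hd.2 d, ENNReal.ofReal_prod_of_nonneg]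
    intro q _
    exact hw q _
  simp only [hdd]
  rw [← ENNReal.ofReal_sum_of_nonneg (fun d _ => Finset.prod_nonneg fun q _ => hw q _)]
  apply ENNReal.ofReal_le_ofReal
  calc ∑ d ∈ Finset.univ.filter (fun d : EdgeData n => a ≤ l * (wins d i : ℝ)),
        ∏ q : Pair n, pairWeight p (ρ q.1.1 q.1.2) (d q)
      ≤ ∑ d ∈ Finset.univ.filter (fun d : EdgeData n => a ≤ l * (wins d i : ℝ)),
        (∏ q : Pair n, pairWeight p (ρ q.1.1 q.1.2) (d q)) *
          Real.exp (l * (wins d i : ℝ) - a) := by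
        refine Finset.sum_le_sum fun d hd => ?_
        have h := (Finset.mem_filter.1 hd).2
        exact le_mul_of_one_le_right (Finset.prod_nonneg fun q _ => hw q _)
          (Real.one_le_exp (by linarith))
    _ ≤ ∑ d : EdgeData n, (∏ q : Pair n, pairWeight p (ρ q.1.1 q.1.2) (d q)) *
          Real.exp (l * (wins d i : ℝ) - a) := by
        refine Finset.sum_le_sum_of_subset_of_nonneg (Finset.filter_subset _ _) fun d _ _ => ?_
        exact mul_nonneg (Finset.prod_nonneg fun q _ => hw q _) (Real.exp_pos _).le
    _ = (∑ d : EdgeData n, ∏ q : Pair n, (pairWeight p (ρ q.1.1 q.1.2) (d q) *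
          Real.exp (l * winInd i q (d q)))) * Real.exp (-a) := by
        rw [Finset.sum_mul]
        refine Finset.sum_congr rfl fun d _ => ?_
        rw [Finset.prod_mul_distrib, ← Real.exp_sum, ← Finset.mul_sum, ← wins_eq, mul_assoc,
          ← Real.exp_add, sub_eq_add_neg]
    _ = (∏ q : Pair n, ∑ o : Option Bool, (pairWeight p (ρ q.1.1 q.1.2) o *
          Real.exp (l * winInd i q o))) * Real.exp (-a) := by
        rw [Finset.prod_univ_sum, Fintype.piFinset_univ]
    _ ≤ (∏ q : Pair n, Real.exp (p * rwin ρ i q * (Real.exp l - 1))) * Real.exp (-a) := by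
        refine mul_le_mul_of_nonneg_right ?_ (Real.exp_pos _).le
        refine Finset.prod_le_prod (fun q _ => ?_) fun q _ => mgf_pair p l ρ hs i q
        exact Finset.sum_nonneg fun o _ => mul_nonneg (hw q o) (Real.exp_pos _).le
    _ = Real.exp (p * (∑ j, ρ i j - ρ i i) * (Real.exp l - 1) - a) := by
        rw [← Real.exp_sum, ← Finset.sum_mul, ← Finset.mul_sum, sum_rwin, ← Real.exp_add,
          ← sub_eq_add_neg]

/-- Chernoff bound: two-sided via the sign of `l`. -/
lemma data_tail {Ω : Type} [MeasurableSpace Ω] (μ : Measure Ω) (n : ℕ) (p : ℝ)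
    (ρ : Fin n → Fin n → ℝ) (data : Ω → EdgeData n) (hp : 0 < p) (hp1 : p ≤ 1)
    (h0 : ∀ i j, 0 ≤ ρ i j) (hs : ∀ i j, ρ i j + ρ j i = 1) (hd : IsNPModel μ n p ρ data)
    (i : Fin n) (l t : ℝ) (hl : |l| ≤ 1) :
    μ {ω | t ≤ l * ((wins (data ω) i : ℝ) - p * (∑ j, ρ i j - ρ i i))} ≤
      ENNReal.ofReal (Real.exp (n * p * l ^ 2 - t)) := by
  have h := data_markov μ n p ρ data hp hp1 h0 hs hd i l (t + l * (p * (∑ j, ρ i j - ρ i i)))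
  have e : {ω | t ≤ l * ((wins (data ω) i : ℝ) - p * (∑ j, ρ i j - ρ i i))} =
      {ω | t + l * (p * (∑ j, ρ i j - ρ i i)) ≤ l * (wins (data ω) i : ℝ)} := by
    ext ω
    simp only [Set.mem_ofPred_eq]
    constructor <;> intro h <;> linarith
  rw [e]
  refine h.trans (ENNReal.ofReal_le_ofReal (Real.exp_le_exp.2 ?_))
  have hle : ∑ j, ρ i j ≤ n := by
    calc ∑ j, ρ i j ≤ ∑ j : Fin n, (1:ℝ) := Finset.sum_le_sum fun j _ => by
          have := h0 j i; have := hs i j; linarith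
      _ = n := by simp
  have hge : 0 ≤ ∑ j, ρ i j - ρ i i :=
    sub_nonneg.2 (Finset.single_le_sum (fun j _ => h0 i j) (Finset.mem_univ i))
  have hii := h0 i i
  have hx := (abs_le.1 (Real.abs_exp_sub_one_sub_id_le hl)).2
  have hM0 : 0 ≤ p * (∑ j, ρ i j - ρ i i) := mul_nonneg hp.le hge
  have hM : p * (∑ j, ρ i j - ρ i i) ≤ n * p := by nlinarith
  generalize p * (∑ j, ρ i j - ρ i i) = M at *
  nlinarith [mul_le_mul_of_nonneg_left hx hM0, mul_le_mul_of_nonneg_right hM (sq_nonneg l)]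

lemma combin {n k m : ℕ} (σ : Equiv.Perm (Fin n)) (hm1 : m + 1 ≤ k) (hm2 : k + m + 1 ≤ n)
    (S : Finset (Fin n)) (hS : S.card = k)
    (h : 2 * m < (symmDiff S ((Finset.univ.filter
            fun j : Fin n => (j : ℕ) < k).image σ)).card) :
    ∃ a b : Fin n, (a : ℕ) ≤ k - m - 1 ∧ k + m ≤ (b : ℕ) ∧ σ a ∉ S ∧ σ b ∈ S := by
  classical
  set T := (Finset.univ.filter fun j : Fin n => (j : ℕ) < k).image σ with hT
  have hTc : T.card = k := by
    rw [hT, Finset.card_image_of_injective _ σ.injective]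
    rw [Fin.card_filter_val_lt]
    omega
  have hc : (S \ T).card = (T \ S).card := Finset.card_sdiff_comm (hS.trans hTc.symm)
  have hsum : (symmDiff S T).card = (S \ T).card + (T \ S).card := by
    rw [symmDiff_def, Finset.sup_eq_union, Finset.card_union_of_disjoint disjoint_sdiff_sdiff]
  have hmem : ∀ j, σ j ∈ T ↔ (j : ℕ) < k := by
    intro j
    simp [hT]
  have key : ∀ (A : Finset (Fin n)) (c : ℕ), m < A.card →
      ∃ x ∈ A, ¬ (c ≤ ((σ.symm x : Fin n) : ℕ) ∧ ((σ.symm x : Fin n) : ℕ) < c + m) := by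
    intro A c hA
    by_contra hcon
    push Not at hcon
    have : A.card ≤ (Finset.Ico c (c + m)).card := by
      refine Finset.card_le_card_of_injOn (fun x => ((σ.symm x : Fin n) : ℕ)) ?_ ?_
      · intro x hx
        simpa using hcon x hx
      · intro x _ y _ hxy
        exact σ.symm.injective (Fin.ext hxy)
    simp at this
    omega
  obtain ⟨x, hx, hx2⟩ := key (T \ S) (k - m) (by omega)
  obtain ⟨y, hy, hy2⟩ := key (S \ T) k (by omega)
  rw [Finset.mem_sdiff] at hx hy
  have hx3 := hmem (σ.symm x)
  have hy3 := hmem (σ.symm y)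
  rw [Equiv.apply_symm_apply] at hx3 hy3
  have hx4 := hx3.1 hx.1
  have hy4 : ¬ _ := fun h => hy.2 (hy3.2 h)
  refine ⟨σ.symm x, σ.symm y, by omega, by omega, by simpa using hx.2, by simpa using hy.1⟩

/-- Theorem 3: nonparametric top-k recovery by noisy counts, edge DP.
There are universal constants `C₀, C'` such that for every `C ≥ C₀` the following
holds.  Let `ρ` be a pairwise probability matrix (`ρ + ρᵀ = 11ᵀ`), let `σ` sort the
average winning probabilities `τ` in decreasing order, and suppose the separation
`τ_(k-m) - τ_(k+m+1) ≥ C (√(log n/(np)) + log n/(npε))` holds.  Let `N_i` be item `i`'s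
number of wins and `W` i.i.d. Laplace(2/ε) noise; then the probability that some
top-`k` set `S̃` of the noisy counts `N + W` has Hamming distance more than `2m` from
the true top-`k` set `S_k` is at most `C' n⁻⁵`. -/
theorem statement7 : ∃ C₀ C' : ℝ, 0 < C₀ ∧ 0 < C' ∧
    ∀ C : ℝ, C₀ ≤ C →
    ∀ (n k m : ℕ) (p ε : ℝ) (ρ : Fin n → Fin n → ℝ) (σ : Equiv.Perm (Fin n)),
      0 < p → p ≤ 1 → 0 < ε →
      (hk1 : 1 ≤ k) → (hk2 : k + 1 ≤ n) → (hm1 : m + 1 ≤ k) → (hm2 : k + m + 1 ≤ n) →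
      (∀ i j, 0 ≤ ρ i j) → (∀ i j, ρ i j + ρ j i = 1) →
      (∀ a b : Fin n, a ≤ b → tau n ρ (σ b) ≤ tau n ρ (σ a)) →
      tau n ρ (σ ⟨k + m, by omega⟩) +
          C * (Real.sqrt (Real.log n / (n * p)) + Real.log n / (n * p * ε)) ≤
        tau n ρ (σ ⟨k - m - 1, by omega⟩) →
    ∀ (Ω : Type) (_ : MeasurableSpace Ω) (μ : Measure Ω), IsProbabilityMeasure μ →
    ∀ (data : Ω → EdgeData n) (W : Ω → Fin n → ℝ),
      IsNPModel μ n p ρ data → IsLaplaceNoise μ n (2 / ε) W → IndepFun data W μ →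
      μ {ω | ∃ S : Finset (Fin n), S.card = k ∧
          (∀ i ∈ S, ∀ j ∉ S,
            (wins (data ω) j : ℝ) + W ω j ≤ (wins (data ω) i : ℝ) + W ω i) ∧
          2 * m < (symmDiff S ((Finset.univ.filter
            fun j : Fin n => (j : ℕ) < k).image σ)).card} ≤
        ENNReal.ofReal (C' / n ^ 5) := by
  refine ⟨48, 3, by norm_num, by norm_num, ?_⟩
  intro C hC n k m p ε ρ σ hp hp1 hε hk1 hk2 hm1 hm2 h0 hs hmono hgap Ω _ μ _ data W hd hW _
  have hn2 : 2 ≤ n := by omega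
  have hnR : (2:ℝ) ≤ n := by exact_mod_cast hn2
  have hn0 : (0:ℝ) < n := by linarith
  have hL : 0 < Real.log n := Real.log_pos (by linarith)
  set L := Real.log n with hLdef
  have hnp : 0 < n * p := mul_pos hn0 hp
  set s := Real.sqrt (L / (n * p)) with hsdef
  have hs0 : 0 < s := Real.sqrt_pos.2 (div_pos hL hnp)
  have hs2 : n * p * s ^ 2 = L := by
    rw [hsdef, Real.sq_sqrt (div_pos hL hnp).le]; field_simp
  have hB0 : 0 < L / ε := div_pos hL hε
  have hB : n * p * (L / (n * p * ε)) = L / ε := by field_simp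
  have hB1 : 0 < L / (n * p * ε) := by positivity
  have htau0 : ∀ i, 0 ≤ tau n ρ i := fun i =>
    div_nonneg (Finset.sum_nonneg fun j _ => h0 i j) hn0.le
  have htau1 : ∀ i, tau n ρ i ≤ 1 := by
    intro i
    unfold tau
    rw [div_le_one hn0]
    calc ∑ j, ρ i j ≤ ∑ j : Fin n, (1:ℝ) := Finset.sum_le_sum fun j _ => by
          have := h0 j i; have := hs i j; linarith
      _ = n := by simp
  have hC0 : 0 < C := by linarith
  have hCs : C * s ≤ 1 := by
    have h1 := htau0 (σ ⟨k + m, by omega⟩)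
    have h2 := htau1 (σ ⟨k - m - 1, by omega⟩)
    have : 0 < C * (L / (n * p * ε)) := mul_pos hC0 hB1
    nlinarith
  have hCs0 : 0 < C * s := mul_pos hC0 hs0
  have hexp : Real.exp (-6 * L) = 1 / n ^ 6 := by
    have : -6 * L = -((6:ℕ) * L) := by push_cast; ring
    rw [this, Real.exp_neg, Real.exp_nat_mul, hLdef, Real.exp_log hn0, one_div]
  set M : Fin n → ℝ := fun i => p * (∑ j, ρ i j - ρ i i) with hM
  have hMtau : ∀ i, M i = n * p * tau n ρ i - p / 2 := by
    intro i
    have : ρ i i = 1 / 2 := by have := hs i i; linarith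
    simp only [hM, tau, this]
    field_simp
  -- tails
  have hup : ∀ i, μ {ω | C ^ 2 / 32 * L ≤ (C / 8 * s) * ((wins (data ω) i : ℝ) - M i)} ≤
      ENNReal.ofReal (1 / n ^ 6) := by
    intro i
    refine (data_tail μ n p ρ data hp hp1 h0 hs hd i (C / 8 * s) (C ^ 2 / 32 * L) ?_).trans ?_
    · rw [abs_of_pos (by positivity)]; linarith
    · rw [← hexp]
      refine ENNReal.ofReal_le_ofReal (Real.exp_le_exp.2 ?_)
      have : n * p * (C / 8 * s) ^ 2 = C ^ 2 / 64 * L := by rw [← hs2]; ring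
      rw [this]
      have hC2 : (48:ℝ) ^ 2 ≤ C ^ 2 := pow_le_pow_left₀ (by norm_num) hC 2
      nlinarith [mul_le_mul_of_nonneg_right hC2 hL.le]
  have hlo : ∀ i, μ {ω | C ^ 2 / 32 * L ≤ (-(C / 8 * s)) * ((wins (data ω) i : ℝ) - M i)} ≤
      ENNReal.ofReal (1 / n ^ 6) := by
    intro i
    refine (data_tail μ n p ρ data hp hp1 h0 hs hd i (-(C / 8 * s)) (C ^ 2 / 32 * L) ?_).trans ?_
    · rw [abs_neg, abs_of_pos (by positivity)]; linarith
    · rw [← hexp]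
      refine ENNReal.ofReal_le_ofReal (Real.exp_le_exp.2 ?_)
      have : n * p * (-(C / 8 * s)) ^ 2 = C ^ 2 / 64 * L := by rw [← hs2]; ring
      rw [this]
      have hC2 : (48:ℝ) ^ 2 ≤ C ^ 2 := pow_le_pow_left₀ (by norm_num) hC 2
      nlinarith [mul_le_mul_of_nonneg_right hC2 hL.le]
  have hno : ∀ i, μ {ω | C / 4 * (L / ε) < |W ω i|} ≤ ENNReal.ofReal (1 / n ^ 6) := by
    intro i
    refine (noise_tail μ n (2 / ε) (C / 4 * (L / ε)) (by positivity) (by positivity) W hW i).trans ?_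
    rw [← hexp]
    refine ENNReal.ofReal_le_ofReal (Real.exp_le_exp.2 ?_)
    have : -(C / 4 * (L / ε)) / (2 / ε) = -(C / 8) * L := by field_simp; ring
    rw [this]
    nlinarith
  -- inclusion
  have hsub : {ω | ∃ S : Finset (Fin n), S.card = k ∧
          (∀ i ∈ S, ∀ j ∉ S,
            (wins (data ω) j : ℝ) + W ω j ≤ (wins (data ω) i : ℝ) + W ω i) ∧
          2 * m < (symmDiff S ((Finset.univ.filter
            fun j : Fin n => (j : ℕ) < k).image σ)).card} ⊆
      ⋃ i : Fin n, ({ω | C ^ 2 / 32 * L ≤ (C / 8 * s) * ((wins (data ω) i : ℝ) - M i)} ∪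
        {ω | C ^ 2 / 32 * L ≤ (-(C / 8 * s)) * ((wins (data ω) i : ℝ) - M i)}) ∪
        {ω | C / 4 * (L / ε) < |W ω i|} := by
    rintro ω ⟨S, hSc, hSt, hSd⟩
    by_contra hcon
    simp only [Set.mem_iUnion, Set.mem_union, Set.mem_ofPred_eq, not_exists, not_or, not_le,
      not_lt] at hcon
    obtain ⟨a, b, ha, hb, haS, hbS⟩ := combin σ hm1 hm2 S hSc hSd
    have hle := hSt _ hbS _ haS
    have hA := hcon (σ a)
    have hBb := hcon (σ b)
    have ha' := hmono a ⟨k - m - 1, by omega⟩ (Fin.mk_le_mk.2 ha)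
    have hb' := hmono ⟨k + m, by omega⟩ b (Fin.mk_le_mk.2 hb)
    have hg : tau n ρ (σ b) + C * (s + L / (n * p * ε)) ≤ tau n ρ (σ a) := by linarith
    have hMg : M (σ b) + C * (n * p * s + L / ε) ≤ M (σ a) := by
      rw [hMtau, hMtau, ← hB]
      nlinarith [mul_le_mul_of_nonneg_left hg hnp.le]
    have e : C ^ 2 / 32 * L = (C / 8 * s) * (C / 4 * (n * p * s)) := by rw [← hs2]; ring
    have hl : 0 < C / 8 * s := by positivity
    have h1 : (wins (data ω) (σ b) : ℝ) - M (σ b) < C / 4 * (n * p * s) := by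
      have := hBb.1.1
      rw [e] at this
      exact lt_of_mul_lt_mul_left this hl.le
    have h2 : -((wins (data ω) (σ a) : ℝ) - M (σ a)) < C / 4 * (n * p * s) := by
      have := hA.1.2
      rw [e, neg_mul, ← mul_neg] at this
      exact lt_of_mul_lt_mul_left this hl.le
    have h3 := (abs_le.1 hA.2).1
    have h4 := (abs_le.1 hBb.2).2
    have h5 : 0 < C * (n * p * s) := by positivity
    have h6 : 0 < C * (L / ε) := by positivity
    linarith
  refine (measure_mono hsub).trans ((measure_iUnion_fintype_le μ _).trans ?_)
  have hx0 : (0:ℝ) ≤ 1 / n ^ 6 := by positivity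
  calc _ ≤ ∑ i : Fin n, ENNReal.ofReal (3 * (1 / n ^ 6)) := by
        refine Finset.sum_le_sum fun i _ => ?_
        refine (measure_union_le _ _).trans ?_
        refine (add_le_add ((measure_union_le _ _).trans (add_le_add (hup i) (hlo i)))
          (hno i)).trans ?_
        rw [← ENNReal.ofReal_add hx0 hx0, ← ENNReal.ofReal_add (by positivity) hx0]
        exact ENNReal.ofReal_le_ofReal (by linarith)
    _ = ENNReal.ofReal (3 / n ^ 5) := by
        rw [← ENNReal.ofReal_sum_of_nonneg (fun _ _ => by positivity)]
        congr 1
        simp only [Finset.sum_const, Finset.card_univ, Fintype.card_fin, nsmul_eq_mul]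
        field_simp

end PrivateRanking
end

section
/- In the individual-comparison model, let N_i be the total number of comparisons won by item i over all m users and L comparisons per user, let W₁,…,W_n be i.i.d. Laplace(L/ε), and let S̃_k be the index set of the k largest values among {N_i + W_i}. There exists a constant C > 0 such that, for any k ∈ [n−1] and tolerance u ∈ {0,1,…,min(k−1,n−k−1)}, if the pairwise probability matrix ρ satisfies τ_{(k−u)} − τ_{(k+u+1)} ≥ C(√(n log n/m) + n log n/(mε)), then P( d_H(S̃_k, S_k) > 2u ) = O(n^{−5}). In particular, for u = 0, exact recovery S̃_k = S_k holds with probability 1 − O(n^{−5}) provided τ_{(k)} − τ_{(k+1)} ≥ C(√(n log n/m) + n log n/(mε)). -/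
open MeasureTheory ProbabilityTheory
open scoped ENNReal

namespace PrivateRanking

/-- A dataset in the individual-comparison model: each of `m` users reports `L`
comparisons, each consisting of a pair `(i,j)` with `i < j` together with the outcome
(`true` iff the lower-indexed item `i` won). -/
abbrev IndData (n m L : ℕ) := Fin m → Fin L → Pair n × Bool

/-- Individual adjacency: the two datasets agree on the comparisons of every user
except (at most) one. -/
def IndAdjacent {n m L : ℕ} (d d' : IndData n m L) : Prop :=
  ∃ k₀, ∀ k, k ≠ k₀ → d k = d' k

/-- The negative log-likelihood in the individual-comparison model. -/
noncomputable def nllInd (n m L : ℕ) (F : ℝ → ℝ) (θ : Fin n → ℝ)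
    (d : IndData n m L) : ℝ :=
  ∑ k, ∑ l, nllTerm F (θ (d k l).1.1.1 - θ (d k l).1.1.2) (d k l).2

/-- The perturbed, ridge-regularized objective in the individual-comparison model. -/
noncomputable def pobjInd (n m L : ℕ) (F : ℝ → ℝ) (γ : ℝ) (w : Fin n → ℝ)
    (d : IndData n m L) (θ : Fin n → ℝ) : ℝ :=
  nllInd n m L F θ d + γ / 2 * ∑ i, θ i ^ 2 + ∑ i, w i * θ i

/-- The probability weight of a single reported comparison `(q, b)` in the individual
model: the pair is uniform among the `n choose 2` pairs and the lower-indexed item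
wins with probability `ρwin`. -/
noncomputable def indWeight (n : ℕ) (ρwin : ℝ) (b : Bool) : ℝ :=
  (n.choose 2 : ℝ)⁻¹ * (if b then ρwin else 1 - ρwin)

/-- `data` follows the parametric individual-comparison model: all `mL` comparisons are
independent, each pair is uniform, and item `i` beats `j` with probability
`F (θ i - θ j)`. -/
def IsIndParamModel {Ω : Type*} [MeasurableSpace Ω] (μ : Measure Ω) (n m L : ℕ)
    (F : ℝ → ℝ) (θ : Fin n → ℝ) (data : Ω → IndData n m L) : Prop :=
  Measurable data ∧
    ∀ d : IndData n m L, μ {ω | data ω = d} =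
      ∏ k, ∏ l, ENNReal.ofReal
        (indWeight n (F (θ (d k l).1.1.1 - θ (d k l).1.1.2)) (d k l).2)

/-- The total number of comparisons won by item `i` over all users and draws. -/
def winsInd {n m L : ℕ} (d : IndData n m L) (i : Fin n) : ℕ :=
  (Finset.univ.filter fun t : Fin m × Fin L =>
    ((d t.1 t.2).1.1.1 = i ∧ (d t.1 t.2).2 = true) ∨
    ((d t.1 t.2).1.1.2 = i ∧ (d t.1 t.2).2 = false)).card

/-- `data` follows the nonparametric individual-comparison model: all `mL` comparisons
are independent, each pair uniform, and item `i` beats `j` with probability `ρ i j`. -/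
def IsIndNPModel {Ω : Type*} [MeasurableSpace Ω] (μ : Measure Ω) (n m L : ℕ)
    (ρ : Fin n → Fin n → ℝ) (data : Ω → IndData n m L) : Prop :=
  Measurable data ∧
    ∀ d : IndData n m L, μ {ω | data ω = d} =
      ∏ k, ∏ l, ENNReal.ofReal
        (indWeight n (ρ (d k l).1.1.1 (d k l).1.1.2) (d k l).2)

lemma lap_tail (b t : ℝ) (hb : 0 < b) (ht : 0 ≤ t) :
    laplaceMeasure b {x | t ≤ |x|} ≤ ENNReal.ofReal (Real.exp (-t / b)) := by
  have key : ∫⁻ x in Set.Ioi t, ENNReal.ofReal ((2 * b)⁻¹ * Real.exp (-x / b)) =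
      ENNReal.ofReal (Real.exp (-t / b) / 2) := by
    have hneg : -b⁻¹ < 0 := by simpa using hb
    have e : ∀ x : ℝ, -x / b = -b⁻¹ * x := fun x => by field_simp
    rw [← ofReal_integral_eq_lintegral_ofReal]
    · congr 1
      simp_rw [e]
      rw [integral_const_mul, integral_exp_mul_Ioi hneg]
      field_simp
    · simp_rw [e]
      exact (integrableOn_exp_mul_Ioi hneg t).const_mul _
    · exact Filter.Eventually.of_forall fun x => by positivity
  have sub : {x : ℝ | t ≤ |x|} ⊆ Set.Ici t ∪ Set.Iic (-t) := by
    intro x hx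
    have hx' : t ≤ |x| := hx
    rcases le_abs.1 hx' with h | h
    · exact Or.inl h
    · exact Or.inr (by simp only [Set.mem_Iic]; linarith)
  have h1 : laplaceMeasure b (Set.Ici t) = ENNReal.ofReal (Real.exp (-t / b) / 2) := by
    rw [laplaceMeasure, withDensity_apply _ measurableSet_Ici,
      setLIntegral_congr Ioi_ae_eq_Ici.symm, ← key]
    refine setLIntegral_congr_fun measurableSet_Ioi ?_
    intro x hx
    simp only [Set.mem_Ioi] at hx
    simp only
    rw [abs_of_pos (by linarith)]
  have h2 : laplaceMeasure b (Set.Iic (-t)) = ENNReal.ofReal (Real.exp (-t / b) / 2) := by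
    rw [← h1, laplaceMeasure, withDensity_apply _ measurableSet_Ici,
      withDensity_apply _ measurableSet_Iic]
    have := (Measure.measurePreserving_neg (volume : Measure ℝ)).setLIntegral_comp_preimage
      (measurableSet_Ici (a := t))
      (f := fun x => ENNReal.ofReal ((2 * b)⁻¹ * Real.exp (-|x| / b))) (by fun_prop)
    rw [← this]
    simp
  calc _ ≤ _ := measure_mono sub
    _ ≤ _ := measure_union_le _ _
    _ = _ := by
      rw [h1, h2, ← ENNReal.ofReal_add (by positivity) (by positivity)]
      congr 1; ring

lemma lap_univ (b : ℝ) (hb : 0 < b) : laplaceMeasure b Set.univ ≤ 1 := by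
  have := lap_tail b 0 hb le_rfl
  simpa using this

lemma lapPi_tail (n : ℕ) (b t : ℝ) (hb : 0 < b) (ht : 0 ≤ t) (i : Fin n) :
    laplacePi n b {x | t ≤ |x i|} ≤ ENNReal.ofReal (Real.exp (-t / b)) := by
  haveI : IsFiniteMeasure (laplaceMeasure b) := ⟨(lap_univ b hb).trans_lt (by simp)⟩
  have e : {x : Fin n → ℝ | t ≤ |x i|} =
      Set.univ.pi (fun j => if j = i then {x : ℝ | t ≤ |x|} else Set.univ) := by
    ext x
    simp only [Set.mem_setOf_eq, Set.mem_univ_pi]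
    constructor
    · intro h j
      by_cases hj : j = i
      · subst hj; simpa using h
      · simp [hj]
    · intro h; simpa using h i
  rw [e, laplacePi, Measure.pi_pi, ← Finset.mul_prod_erase _ _ (Finset.mem_univ i)]
  simp only [if_true]
  calc _ ≤ laplaceMeasure b {x | t ≤ |x|} * 1 := by
        gcongr
        refine Finset.prod_le_one' ?_
        intro j hj
        rw [if_neg (Finset.ne_of_mem_erase hj)]
        exact lap_univ b hb
    _ ≤ _ := by rw [mul_one]; exact lap_tail b t hb ht

lemma sum_pair (n : ℕ) (f : Fin n → Fin n → ℝ) :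
    ∑ q : Pair n, f q.1.1 q.1.2 = ∑ a, ∑ b, if a < b then f a b else 0 := by
  rw [← Fintype.sum_prod_type' (f := fun a b => if a < b then f a b else 0),
    ← Finset.sum_filter]
  exact (Finset.sum_subtype (p := fun q : Fin n × Fin n => q.1 < q.2)
    (Finset.univ.filter fun q : Fin n × Fin n => q.1 < q.2) (by simp)
    (fun q => f q.1 q.2)).symm

lemma card_pair (n : ℕ) : (Fintype.card (Pair n) : ℝ) * 2 = n * (n - 1) := by
  have h := sum_pair n (fun _ _ => 1)
  have h' : ∑ a : Fin n, ∑ b : Fin n, (if a < b then (1:ℝ) else 0) =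
      ∑ a : Fin n, ∑ b : Fin n, (if b < a then (1:ℝ) else 0) := Finset.sum_comm
  have h3 : ∑ a : Fin n, ∑ b : Fin n, (if a < b then (1:ℝ) else 0) +
      ∑ a : Fin n, ∑ b : Fin n, (if b < a then (1:ℝ) else 0) = n * (n - 1) := by
    rw [← Finset.sum_add_distrib]
    simp_rw [← Finset.sum_add_distrib]
    have : ∀ a b : Fin n, (if a < b then (1:ℝ) else 0) + (if b < a then (1:ℝ) else 0) =
      1 - if a = b then 1 else 0 := by
      intro a b
      rcases lt_trichotomy a b with h | h | h
      · simp [h, h.ne, h.not_gt]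
      · simp [h]
      · simp [h, h.ne', h.not_gt]
    simp_rw [this]
    simp
    ring
  simp at h
  simp at h' h3 ⊢
  linarith

lemma choose_inv (n : ℕ) : ((n.choose 2 : ℕ) : ℝ) = Fintype.card (Pair n) := by
  have := card_pair n
  rw [Nat.cast_choose_two]; linarith

/-- indicator that item `i` wins comparison `x`. -/
def winI {n : ℕ} (i : Fin n) (x : Pair n × Bool) : ℝ :=
  if (x.1.1.1 = i ∧ x.2 = true) ∨ (x.1.1.2 = i ∧ x.2 = false) then 1 else 0

lemma winsInd_eq {n m L : ℕ} (d : IndData n m L) (i : Fin n) :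
    (winsInd d i : ℝ) = ∑ k, ∑ l, winI i (d k l) := by
  rw [winsInd, Finset.card_filter, Fintype.sum_prod_type]
  push_cast
  rfl

/-- weight -/
noncomputable def wgt {n : ℕ} (ρ : Fin n → Fin n → ℝ) (x : Pair n × Bool) : ℝ :=
  indWeight n (ρ x.1.1.1 x.1.1.2) x.2

lemma wgt_nonneg {n : ℕ} (ρ : Fin n → Fin n → ℝ) (h0 : ∀ i j, 0 ≤ ρ i j)
    (h1 : ∀ i j, ρ i j + ρ j i = 1) (x) : 0 ≤ wgt ρ x := by
  unfold wgt indWeight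
  have := h0 x.1.1.1 x.1.1.2
  have := h0 x.1.1.2 x.1.1.1
  have := h1 x.1.1.1 x.1.1.2
  split_ifs
  · positivity
  · exact mul_nonneg (by positivity) (by linarith)

lemma sum_wgt {n : ℕ} (ρ : Fin n → Fin n → ℝ) (hn : 2 ≤ n) : ∑ x, wgt ρ x = 1 := by
  have hc := card_pair n
  have hn' : (2:ℝ) ≤ n := by exact_mod_cast hn
  rw [Fintype.sum_prod_type]
  simp only [wgt, indWeight, Fintype.sum_bool, if_true, Bool.false_eq_true, if_false]
  have : ∀ q : Pair n, ((n.choose 2 : ℕ) : ℝ)⁻¹ * ρ q.1.1 q.1.2 +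
    ((n.choose 2 : ℕ) : ℝ)⁻¹ * (1 - ρ q.1.1 q.1.2) = ((n.choose 2 : ℕ) : ℝ)⁻¹ := fun q => by ring
  rw [Finset.sum_congr rfl fun q _ => this q, choose_inv, Finset.sum_const, nsmul_eq_mul,
    Finset.card_univ]
  refine mul_inv_cancel₀ ?_
  intro h
  rw [h] at hc
  nlinarith

lemma sum_wgt_win {n : ℕ} (ρ : Fin n → Fin n → ℝ) (hn : 2 ≤ n)
    (h1 : ∀ i j, ρ i j + ρ j i = 1) (i : Fin n) :
    ∑ x, wgt ρ x * winI i x = 2 / (n * (n - 1)) * (n * tau n ρ i - 1 / 2) := by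
  have hn' : (2:ℝ) ≤ n := by exact_mod_cast hn
  rw [Fintype.sum_prod_type]
  simp only [wgt, indWeight, winI, Fintype.sum_bool, if_true, Bool.false_eq_true, if_false,
    and_true, and_false, or_false, false_or, reduceCtorEq]
  have hn1 : (n:ℝ) - 1 ≠ 0 := by intro h; linarith
  have hn0 : (n:ℝ) ≠ 0 := by intro h; linarith
  have hc : ((n.choose 2 : ℕ) : ℝ)⁻¹ = 2 / (n * (n - 1)) := by
    rw [Nat.cast_choose_two]; field_simp
  rw [hc]
  have e := sum_pair n (fun a b => 2 / ((n:ℝ) * (n - 1)) * ρ a b * (if a = i then 1 else 0) +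
    2 / ((n:ℝ) * (n - 1)) * (1 - ρ a b) * (if b = i then 1 else 0))
  rw [e]
  have e2 : ∀ a b : Fin n, (if a < b then (2 / ((n:ℝ) * (n - 1)) * ρ a b * (if a = i then 1 else 0) +
    2 / ((n:ℝ) * (n - 1)) * (1 - ρ a b) * (if b = i then 1 else 0)) else 0) =
     2 / ((n:ℝ) * (n - 1)) * ((if a = i then (if i < b then ρ i b else 0) else 0) +
      (if b = i then (if a < i then ρ i a else 0) else 0)) := by
    intro a b
    have := h1 a b
    by_cases ha : a = i
    · subst ha
      by_cases hb : b = a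
      · subst hb; simp
      · by_cases hab : a < b <;> simp [hb, hab]
    · by_cases hb : b = i
      · subst hb
        by_cases hab : a < b
        · simp [ha, hab]
          left; linarith
        · simp [ha, hab]
      · simp [ha, hb]
  simp_rw [e2, ← Finset.mul_sum, Finset.sum_add_distrib]
  congr 1
  rw [Finset.sum_comm]
  simp only [Finset.sum_ite_eq', Finset.mem_univ, if_true]
  rw [← Finset.sum_add_distrib]
  have e3 : ∀ a : Fin n, (if i < a then ρ i a else 0) + (if a < i then ρ i a else 0) =
      ρ i a - if i = a then ρ i a else 0 := by
    intro a
    rcases lt_trichotomy a i with h | h | h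
    · simp [h, h.ne', h.not_gt]
    · simp [h]
    · simp [h, h.ne, h.not_gt]
  rw [Finset.sum_congr rfl fun a _ => e3 a]
  simp only [Finset.sum_sub_distrib, Finset.sum_ite_eq, Finset.mem_univ, if_true]
  have := h1 i i
  rw [tau, mul_div_cancel₀ _ hn0]
  linarith

lemma ntau_le {n : ℕ} (ρ : Fin n → Fin n → ℝ) (hn : 2 ≤ n) (h0 : ∀ i j, 0 ≤ ρ i j)
    (h1 : ∀ i j, ρ i j + ρ j i = 1) (i : Fin n) : n * tau n ρ i - 1 / 2 ≤ n - 1 := by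
  have hn' : (2:ℝ) ≤ n := by exact_mod_cast hn
  have hn0 : (n:ℝ) ≠ 0 := by intro h; linarith
  rw [tau, mul_div_cancel₀ _ hn0, ← Finset.add_sum_erase _ _ (Finset.mem_univ i)]
  have : ∑ j ∈ Finset.univ.erase i, ρ i j ≤ ∑ j ∈ Finset.univ.erase i, 1 :=
    Finset.sum_le_sum fun j _ => by linarith [h0 j i, h1 i j]
  rw [Finset.sum_const, Finset.card_erase_of_mem (Finset.mem_univ i), Finset.card_univ,
    Fintype.card_fin, nsmul_eq_mul, mul_one, Nat.cast_sub (by omega)] at this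
  have := h1 i i
  push_cast at *
  linarith

lemma tau_nonneg {n : ℕ} (ρ : Fin n → Fin n → ℝ) (h0 : ∀ i j, 0 ≤ ρ i j) (i : Fin n) :
    0 ≤ tau n ρ i := div_nonneg (Finset.sum_nonneg fun j _ => h0 i j) (by positivity)

lemma mgf_one {n : ℕ} (ρ : Fin n → Fin n → ℝ) (hn : 2 ≤ n) (h0 : ∀ i j, 0 ≤ ρ i j)
    (h1 : ∀ i j, ρ i j + ρ j i = 1) (i j : Fin n) (r : ℝ) (hr0 : 0 ≤ r) (hr1 : r ≤ 1)
    (hij : tau n ρ j ≤ tau n ρ i) :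
    ∑ x, wgt ρ x * Real.exp (-r * (winI i x - winI j x)) ≤
      Real.exp (-r * (2 / n * (tau n ρ i - tau n ρ j)) + 4 * r ^ 2 / n) := by
  have hn' : (2:ℝ) ≤ n := by exact_mod_cast hn
  have b1 : ∀ x : Pair n × Bool, Real.exp (-r * (winI i x - winI j x)) ≤
      1 - r * (winI i x - winI j x) + r ^ 2 * (winI i x + winI j x) := by
    intro x
    have hi : winI i x = 0 ∨ winI i x = 1 := by unfold winI; split_ifs <;> simp
    have hj : winI j x = 0 ∨ winI j x = 1 := by unfold winI; split_ifs <;> simp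
    have q1 := Real.abs_exp_sub_one_sub_id_le (x := r) (by rw [abs_of_nonneg hr0]; exact hr1)
    have q2 := Real.abs_exp_sub_one_sub_id_le (x := -r)
      (by rw [abs_neg, abs_of_nonneg hr0]; exact hr1)
    rw [abs_le] at q1 q2
    rcases hi with hi | hi <;> rcases hj with hj | hj <;> rw [hi, hj] <;> ring_nf at * <;>
      first | linarith [q1.2, q2.2] | (simp only [Real.exp_zero]; nlinarith)
  have s1 := sum_wgt_win ρ hn h1 i
  have s2 := sum_wgt_win ρ hn h1 j
  have l1 := ntau_le ρ hn h0 h1 i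
  have l2 := ntau_le ρ hn h0 h1 j
  have hn1 : (0:ℝ) < n - 1 := by linarith
  have hn0 : (0:ℝ) < n := by linarith
  have hc : (0:ℝ) < 2 / (n * (n - 1)) := by positivity
  have hc1 : (2:ℝ) / (n * (n - 1)) * (n - 1) = 2 / n := by field_simp
  calc _ ≤ ∑ x, wgt ρ x * (1 - r * (winI i x - winI j x) + r ^ 2 * (winI i x + winI j x)) :=
        Finset.sum_le_sum fun x _ => mul_le_mul_of_nonneg_left (b1 x) (wgt_nonneg ρ h0 h1 x)
    _ = ∑ x, wgt ρ x - r * (∑ x, wgt ρ x * winI i x - ∑ x, wgt ρ x * winI j x)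
        + r ^ 2 * (∑ x, wgt ρ x * winI i x + ∑ x, wgt ρ x * winI j x) := by
      simp only [← Finset.sum_sub_distrib, ← Finset.sum_add_distrib, Finset.mul_sum]
      exact Finset.sum_congr rfl fun x _ => by ring
    _ ≤ 1 - r * (2 / n * (tau n ρ i - tau n ρ j)) + 4 * r ^ 2 / n := by
      rw [sum_wgt ρ hn, s1, s2]
      have a1 : 2 / n * (tau n ρ i - tau n ρ j) ≤
        2 / (n * (n - 1)) * (n * tau n ρ i - 1 / 2) - 2 / (n * (n - 1)) * (n * tau n ρ j - 1 / 2) := by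
        have : 2 / (n * (n - 1)) * (n * tau n ρ i - 1 / 2) - 2 / (n * (n - 1)) * (n * tau n ρ j - 1 / 2)
          = 2 / (n - 1) * (tau n ρ i - tau n ρ j) := by field_simp; ring
        rw [this]
        refine mul_le_mul_of_nonneg_right ?_ (by linarith)
        exact div_le_div_of_nonneg_left (by norm_num) hn1 (by linarith)
      have a2 := mul_le_mul_of_nonneg_left l1 hc.le
      have a3 := mul_le_mul_of_nonneg_left l2 hc.le
      rw [hc1] at a2 a3
      have a4 := mul_le_mul_of_nonneg_left (add_le_add a2 a3) (sq_nonneg r)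
      have a5 := mul_le_mul_of_nonneg_left a1 hr0
      have a6 : r ^ 2 * (2 / n + 2 / n) = 4 * r ^ 2 / (n:ℝ) := by ring
      linarith
    _ ≤ _ := by
      have := Real.add_one_le_exp (-r * (2 / n * (tau n ρ i - tau n ρ j)) + 4 * r ^ 2 / n)
      linarith

lemma chernoff {n m L : ℕ} (ρ : Fin n → Fin n → ℝ) (hn : 2 ≤ n) (h0 : ∀ i j, 0 ≤ ρ i j)
    (h1 : ∀ i j, ρ i j + ρ j i = 1) (i j : Fin n) (r : ℝ) (hr0 : 0 ≤ r) (hr1 : r ≤ 1)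
    (hij : tau n ρ j ≤ tau n ρ i) (s : ℝ)
    {Ω : Type} [MeasurableSpace Ω] (μ : Measure Ω)
    (data : Ω → IndData n m L) (hd : IsIndNPModel μ n m L ρ data) :
    μ {ω | (winsInd (data ω) i : ℝ) - winsInd (data ω) j ≤ s} ≤
      ENNReal.ofReal (Real.exp (r * s + m * L *
        (-r * (2 / n * (tau n ρ i - tau n ρ j)) + 4 * r ^ 2 / n))) := by
  have hw := wgt_nonneg ρ h0 h1
  set X : Pair n × Bool → ℝ := fun x => winI i x - winI j x with hX
  have hsub : {ω | (winsInd (data ω) i : ℝ) - winsInd (data ω) j ≤ s} ⊆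
      ⋃ d ∈ (Finset.univ.filter fun d : IndData n m L =>
        (winsInd d i : ℝ) - winsInd d j ≤ s), {ω | data ω = d} := by
    intro ω hω
    simp only [Set.mem_iUnion]
    exact ⟨data ω, by simpa using hω, rfl⟩
  have hWX : ∀ d : IndData n m L, (winsInd d i : ℝ) - winsInd d j = ∑ k, ∑ l, X (d k l) := by
    intro d
    rw [winsInd_eq, winsInd_eq]
    simp only [← Finset.sum_sub_distrib, hX]
  have hdd : ∀ d, μ {ω | data ω = d} = ENNReal.ofReal (∏ k, ∏ l, wgt ρ (d k l)) := by
    intro d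
    rw [hd.2 d, ENNReal.ofReal_prod_of_nonneg
      (fun k _ => Finset.prod_nonneg fun l _ => hw _)]
    refine Finset.prod_congr rfl fun k _ => ?_
    rw [ENNReal.ofReal_prod_of_nonneg (fun l _ => hw _)]
    rfl
  calc _ ≤ _ := measure_mono hsub
    _ ≤ _ := measure_biUnion_finset_le _ _
    _ = ENNReal.ofReal (∑ d ∈ (Finset.univ.filter fun d : IndData n m L =>
        (winsInd d i : ℝ) - winsInd d j ≤ s), ∏ k, ∏ l, wgt ρ (d k l)) := by
      rw [ENNReal.ofReal_sum_of_nonneg]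
      · exact Finset.sum_congr rfl fun d _ => hdd d
      · intro d _
        exact Finset.prod_nonneg fun k _ => Finset.prod_nonneg fun l _ => hw _
    _ ≤ _ := by
      apply ENNReal.ofReal_le_ofReal
      calc _ ≤ ∑ d ∈ (Finset.univ.filter fun d : IndData n m L =>
            (winsInd d i : ℝ) - winsInd d j ≤ s), Real.exp (r * s) *
              ∏ k, ∏ l, (wgt ρ (d k l) * Real.exp (-r * X (d k l))) := by
            refine Finset.sum_le_sum fun d hd => ?_
            have hd' := (Finset.mem_filter.1 hd).2
            rw [hWX] at hd'
            simp_rw [Finset.prod_mul_distrib, ← Real.exp_sum, ← Finset.mul_sum]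
            rw [mul_left_comm, ← Real.exp_add]
            refine le_mul_of_one_le_right
              (Finset.prod_nonneg fun k _ => Finset.prod_nonneg fun l _ => hw _) ?_
            apply Real.one_le_exp
            nlinarith
        _ ≤ ∑ d : IndData n m L, Real.exp (r * s) *
              ∏ k, ∏ l, (wgt ρ (d k l) * Real.exp (-r * X (d k l))) := by
            refine Finset.sum_le_sum_of_subset_of_nonneg (Finset.filter_subset _ _) ?_
            intro d _ _
            exact mul_nonneg (Real.exp_pos _).le (Finset.prod_nonneg fun k _ =>
              Finset.prod_nonneg fun l _ => mul_nonneg (hw _) (Real.exp_pos _).le)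
        _ = Real.exp (r * s) * ((∑ x, wgt ρ x * Real.exp (-r * X x)) ^ L) ^ m := by
            rw [← Finset.mul_sum, Fintype.sum_pow, Fintype.sum_pow]
        _ ≤ Real.exp (r * s) * ((Real.exp (-r * (2 / n * (tau n ρ i - tau n ρ j)) +
              4 * r ^ 2 / n)) ^ L) ^ m := by
            have : 0 ≤ ∑ x, wgt ρ x * Real.exp (-r * X x) :=
              Finset.sum_nonneg fun x _ => mul_nonneg (hw _) (Real.exp_pos _).le
            gcongr
            exact mgf_one ρ hn h0 h1 i j r hr0 hr1 hij
        _ = _ := by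
            rw [← Real.exp_nat_mul, ← Real.exp_nat_mul, ← Real.exp_add]
            congr 1; ring

lemma comb {n k u : ℕ} (σ : Equiv.Perm (Fin n)) (hk2 : k + 1 ≤ n) (hu1 : u + 1 ≤ k)
    (hu2 : k + u + 1 ≤ n) (S : Finset (Fin n)) (hS : S.card = k)
    (h : 2 * u < (symmDiff S ((Finset.univ.filter
            fun j : Fin n => (j : ℕ) < k).image σ)).card) :
    ∃ a b : Fin n, (a : ℕ) ≤ k - u - 1 ∧ k + u ≤ (b : ℕ) ∧ σ a ∉ S ∧ σ b ∈ S := by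
  set T := (Finset.univ.filter fun j : Fin n => (j : ℕ) < k).image σ with hT
  have cardlt : ∀ p q : ℕ, q ≤ n →
      ((Finset.univ.filter fun j : Fin n => p ≤ (j : ℕ) ∧ (j : ℕ) < q)).card = q - p := by
    intro p q hq
    rw [← Finset.card_map Fin.valEmbedding, ← Nat.card_Ico]
    congr 1
    ext x
    simp only [Finset.mem_map, Finset.mem_filter, Finset.mem_univ, true_and,
      Fin.valEmbedding_apply, Finset.mem_Ico]
    constructor
    · rintro ⟨a, ha, rfl⟩; exact ha
    · intro hx; exact ⟨⟨x, by omega⟩, hx, rfl⟩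
  have hTc : T.card = k := by
    rw [hT, Finset.card_image_of_injective _ σ.injective]
    simpa using cardlt 0 k (by omega)
  have hsd : (symmDiff S T).card = (S \ T).card + (T \ S).card := by
    rw [symmDiff_def, Finset.sup_eq_union, Finset.card_union_of_disjoint disjoint_sdiff_sdiff]
  have e1 := Finset.card_sdiff_add_card_inter S T
  have e2 := Finset.card_sdiff_add_card_inter T S
  rw [Finset.inter_comm] at e2
  have memT : ∀ a, σ a ∈ T ↔ (a : ℕ) < k := by
    intro a; simp [hT]
  obtain ⟨x, hx, hx'⟩ := Finset.exists_mem_notMem_of_card_lt_card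
    (s := (Finset.univ.filter fun j : Fin n => k - u ≤ (j : ℕ) ∧ (j : ℕ) < k).image σ)
    (t := T \ S) (by
      rw [Finset.card_image_of_injective _ σ.injective, cardlt _ _ (by omega)]; omega)
  obtain ⟨y, hy, hy'⟩ := Finset.exists_mem_notMem_of_card_lt_card
    (s := (Finset.univ.filter fun j : Fin n => k ≤ (j : ℕ) ∧ (j : ℕ) < k + u).image σ)
    (t := S \ T) (by
      rw [Finset.card_image_of_injective _ σ.injective, cardlt _ _ (by omega)]; omega)
  obtain ⟨a, rfl⟩ := σ.surjective x
  obtain ⟨b, rfl⟩ := σ.surjective y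
  rw [Finset.mem_sdiff, memT] at hx hy
  simp at hx' hy'
  refine ⟨a, b, ?_, ?_, hx.2, hy.1⟩
  · by_contra hc
    have := hx' (by omega)
    omega
  · by_contra hc
    have := hy' (by omega)
    omega

/-- Theorem 7: nonparametric top-k recovery by noisy counts under
individual DP.  There are universal constants `C, C' > 0` such that the following
holds.  Let `ρ` be a pairwise probability matrix, `σ` a permutation sorting the average
winning probabilities `τ` in decreasing order, `k ∈ [n-1]` and tolerance
`u ≤ min(k-1, n-k-1)`.  Let `N_i` be the total number of wins of item `i` and `W`
i.i.d. Laplace(L/ε) noise.  If `τ_(k-u) - τ_(k+u+1) ≥ C (√(n log n/m) + n log n/(mε))`,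
then the probability that some top-`k` set of the noisy counts `N + W` has Hamming
distance more than `2u` from the true top-`k` set is at most `C' n⁻⁵`. -/
theorem statement12 : ∃ C C' : ℝ, 0 < C ∧ 0 < C' ∧
    ∀ (n m L k u : ℕ) (ε : ℝ) (ρ : Fin n → Fin n → ℝ) (σ : Equiv.Perm (Fin n)),
      1 ≤ L → 1 ≤ m → 0 < ε →
      (hk1 : 1 ≤ k) → (hk2 : k + 1 ≤ n) → (hu1 : u + 1 ≤ k) → (hu2 : k + u + 1 ≤ n) →
      (∀ i j, 0 ≤ ρ i j) → (∀ i j, ρ i j + ρ j i = 1) →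
      (∀ a b : Fin n, a ≤ b → tau n ρ (σ b) ≤ tau n ρ (σ a)) →
      tau n ρ (σ ⟨k + u, by omega⟩) +
          C * (Real.sqrt (n * Real.log n / m) + n * Real.log n / (m * ε)) ≤
        tau n ρ (σ ⟨k - u - 1, by omega⟩) →
    ∀ (Ω : Type) (_ : MeasurableSpace Ω) (μ : Measure Ω), IsProbabilityMeasure μ →
    ∀ (data : Ω → IndData n m L) (W : Ω → Fin n → ℝ),
      IsIndNPModel μ n m L ρ data → IsLaplaceNoise μ n (L / ε) W →
      IndepFun data W μ →
      μ {ω | ∃ S : Finset (Fin n), S.card = k ∧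
          (∀ i ∈ S, ∀ j ∉ S,
            (winsInd (data ω) j : ℝ) + W ω j ≤ (winsInd (data ω) i : ℝ) + W ω i) ∧
          2 * u < (symmDiff S ((Finset.univ.filter
            fun j : Fin n => (j : ℕ) < k).image σ)).card} ≤
        ENNReal.ofReal (C' / n ^ 5) := by
  refine ⟨8, 2, by norm_num, by norm_num, ?_⟩
  intro n m L k u ε ρ σ hL hm hε hk1 hk2 hu1 hu2 h0 h1 hσ hgap Ω _ μ hμ data W hd hW _
  have hn : 2 ≤ n := by omega
  have hn' : (2:ℝ) ≤ n := by exact_mod_cast hn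
  have hn0 : (0:ℝ) < n := by linarith
  have hm' : (1:ℝ) ≤ m := by exact_mod_cast hm
  have hm0 : (0:ℝ) < m := by linarith
  have hL' : (1:ℝ) ≤ L := by exact_mod_cast hL
  have hL0 : (0:ℝ) < L := by linarith
  have hlog : 0 < Real.log n := Real.log_pos (by linarith)
  set lg := Real.log n with hlg
  set r := Real.sqrt (n * lg / m) with hr
  have hr0 : 0 ≤ r := Real.sqrt_nonneg _
  have hr2 : r ^ 2 = n * lg / m := Real.sq_sqrt (by positivity)
  have hq : 0 < n * lg / (m * ε) := by positivity
  have hr1 : r ≤ 1 := by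
    have a1 := ntau_le ρ hn h0 h1 (σ ⟨k - u - 1, by omega⟩)
    have a2 := tau_nonneg ρ h0 (σ ⟨k + u, by omega⟩)
    have a3 : tau n ρ (σ ⟨k - u - 1, by omega⟩) ≤ 1 := by
      by_contra hc
      push Not at hc
      nlinarith
    linarith
  set s := 16 * L * lg / ε with hs
  set t := 8 * L * lg / ε with ht
  have htpos : 0 ≤ t := by positivity
  have pair : ∀ a b : Fin n, (a : ℕ) ≤ k - u - 1 → k + u ≤ (b : ℕ) →
      μ {ω | (winsInd (data ω) (σ a) : ℝ) - winsInd (data ω) (σ b) ≤ s} ≤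
        ENNReal.ofReal (((n:ℝ) ^ 7)⁻¹) := by
    intro a b ha hb
    have t1 := hσ a ⟨k - u - 1, by omega⟩ (by simpa [Fin.le_def] using ha)
    have t2 := hσ ⟨k + u, by omega⟩ b (by simpa [Fin.le_def] using hb)
    have g : 8 * (r + n * lg / (m * ε)) ≤ tau n ρ (σ a) - tau n ρ (σ b) := by linarith
    refine (chernoff ρ hn h0 h1 (σ a) (σ b) r hr0 hr1 (by linarith) s μ data hd).trans ?_
    apply ENNReal.ofReal_le_ofReal
    have e7 : ((n:ℝ) ^ 7)⁻¹ = Real.exp (-(7 * lg)) := by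
      rw [Real.exp_neg, hlg]
      congr 1
      rw [← Real.exp_log (show (0:ℝ) < n ^ 7 by positivity), Real.log_pow]
      norm_num
    rw [e7]
    apply Real.exp_le_exp.2
    have c1 : (m * L * r * (2 / n)) * (8 * (r + n * lg / (m * ε))) ≤
        (m * L * r * (2 / n)) * (tau n ρ (σ a) - tau n ρ (σ b)) :=
      mul_le_mul_of_nonneg_left g (by positivity)
    have c2 : (m * L * r * (2 / n)) * (8 * (r + n * lg / (m * ε))) =
        16 * L * (m * r ^ 2 / n) + r * s := by
      rw [hs]; field_simp; ring
    have c3 : m * r ^ 2 / n = lg := by rw [hr2]; field_simp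
    have c4 : m * L * (4 * r ^ 2 / n) = 4 * L * (m * r ^ 2 / n) := by ring
    rw [c3] at c2 c4
    have c5 : lg ≤ L * lg := by nlinarith
    nlinarith
  have lap : ∀ i : Fin n, μ {ω | t ≤ |W ω i|} ≤ ENNReal.ofReal (((n:ℝ) ^ 6)⁻¹) := by
    intro i
    have hmeas : MeasurableSet {x : Fin n → ℝ | t ≤ |x i|} :=
      measurableSet_le measurable_const (by fun_prop)
    have e : μ {ω | t ≤ |W ω i|} = laplacePi n (L / ε) {x | t ≤ |x i|} := by
      rw [← hW.2, Measure.map_apply hW.1 hmeas]; rfl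
    rw [e]
    refine (lapPi_tail n (L / ε) t (by positivity) htpos i).trans ?_
    apply ENNReal.ofReal_le_ofReal
    have e6 : ((n:ℝ) ^ 6)⁻¹ = Real.exp (-(6 * lg)) := by
      rw [Real.exp_neg, hlg]
      congr 1
      rw [← Real.exp_log (show (0:ℝ) < n ^ 6 by positivity), Real.log_pow]
      norm_num
    rw [e6]
    apply Real.exp_le_exp.2
    have : -t / (L / ε) = -(8 * lg) := by rw [ht]; field_simp
    rw [this]; linarith
  let A : Fin n × Fin n → Set Ω := fun p =>
    if (p.1 : ℕ) ≤ k - u - 1 ∧ k + u ≤ (p.2 : ℕ) then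
      {ω | (winsInd (data ω) (σ p.1) : ℝ) - winsInd (data ω) (σ p.2) ≤ s} else ∅
  have hA : ∀ p, μ (A p) ≤ ENNReal.ofReal (((n:ℝ) ^ 7)⁻¹) := by
    intro p
    by_cases hp : (p.1 : ℕ) ≤ k - u - 1 ∧ k + u ≤ (p.2 : ℕ)
    · simp only [A, if_pos hp]; exact pair _ _ hp.1 hp.2
    · simp only [A, if_neg hp]; simp
  have hsub : {ω | ∃ S : Finset (Fin n), S.card = k ∧
          (∀ i ∈ S, ∀ j ∉ S,
            (winsInd (data ω) j : ℝ) + W ω j ≤ (winsInd (data ω) i : ℝ) + W ω i) ∧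
          2 * u < (symmDiff S ((Finset.univ.filter
            fun j : Fin n => (j : ℕ) < k).image σ)).card} ⊆
      (⋃ p, A p) ∪ ⋃ i, {ω | t ≤ |W ω i|} := by
    rintro ω ⟨S, hS, htop, hlarge⟩
    obtain ⟨a, b, ha, hb, haS, hbS⟩ := comb σ hk2 hu1 hu2 S hS hlarge
    by_cases hw : ∃ i, t ≤ |W ω i|
    · right; simpa using hw
    · left
      push Not at hw
      refine Set.mem_iUnion.2 ⟨(a, b), ?_⟩
      simp only [A, if_pos (And.intro ha hb), Set.mem_setOf_eq]
      have q1 := htop _ hbS _ haS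
      have q2 := abs_lt.1 (hw (σ a))
      have q3 := abs_lt.1 (hw (σ b))
      have : s = t + t := by rw [hs, ht]; ring
      linarith [q2.1, q3.2]
  calc _ ≤ _ := measure_mono hsub
    _ ≤ _ := measure_union_le _ _
    _ ≤ ∑ p, μ (A p) + ∑ i, μ {ω | t ≤ |W ω i|} :=
      add_le_add (measure_iUnion_fintype_le _ _) (measure_iUnion_fintype_le _ _)
    _ ≤ ∑ p : Fin n × Fin n, ENNReal.ofReal (((n:ℝ) ^ 7)⁻¹) +
        ∑ i : Fin n, ENNReal.ofReal (((n:ℝ) ^ 6)⁻¹) :=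
      add_le_add (Finset.sum_le_sum fun p _ => hA p) (Finset.sum_le_sum fun i _ => lap i)
    _ = ENNReal.ofReal (2 / n ^ 5) := by
      rw [← ENNReal.ofReal_sum_of_nonneg (fun _ _ => by positivity),
        ← ENNReal.ofReal_sum_of_nonneg (fun _ _ => by positivity),
        ← ENNReal.ofReal_add (by positivity) (by positivity)]
      congr 1
      simp only [Finset.sum_const, Finset.card_univ, Fintype.card_prod, Fintype.card_fin,
        nsmul_eq_mul, Nat.cast_mul]
      field_simp
      norm_num

end PrivateRanking
end
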